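/- arXiv:funct-an/9704004 — 2 statements merged into one kernel-verified Lean document; each statement's English description precedes it below -/
import Mathlib

section
/- Let (A,Δ) be an algebraic quantum group. The multiplier algebra M(Â) of the dual algebra Â is isomorphic as a vector space to the set {θ ∈ A' : (θ⊙ι)Δ(a) ∈ A and (ι⊙θ)Δ(a) ∈ A for all a ∈ A}, with product (θ₁θ₂)(a) = θ₁((ι⊙θ₂)Δ(a)) = θ₂((θ₁⊙ι)Δ(a)), and the counit ε is the unit of M(Â). -/
open TensorProduct LinearMap

noncomputable section

/-- Slice on the left leg: `sliceL θ (x ⊗ y) = θ x • y`, i.e. `(θ ⊙ ι)`. -/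
def sliceL {M N : Type*} [AddCommGroup M] [Module ℂ M] [AddCommGroup N] [Module ℂ N]
    (θ : M →ₗ[ℂ] ℂ) : M ⊗[ℂ] N →ₗ[ℂ] N :=
  TensorProduct.lift (LinearMap.lsmul ℂ N ∘ₗ θ)

/-- Slice on the right leg: `sliceR θ (x ⊗ y) = θ y • x`, i.e. `(ι ⊙ θ)`. -/
def sliceR {M N : Type*} [AddCommGroup M] [Module ℂ M] [AddCommGroup N] [Module ℂ N]
    (θ : N →ₗ[ℂ] ℂ) : M ⊗[ℂ] N →ₗ[ℂ] M :=
  TensorProduct.lift ((LinearMap.lsmul ℂ M ∘ₗ θ).flip)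

/-- An algebraic quantum group: a regular multiplier Hopf algebra `(A, Δ)` with a
(faithful) left invariant functional `φ`.  The comultiplication is encoded through the
canonical bijections `T1 a ⊗ b = Δ(a)(b ⊗ 1)`, `T2 (a ⊗ b) = Δ(a)(1 ⊗ b)`,
`T3 (a ⊗ b) = (b ⊗ 1)Δ(a)`, `T4 (a ⊗ b) = (1 ⊗ b)Δ(a)` together with the left and right
multiplication operators `ΔL a`/`ΔR a` by `Δ(a)` on `A ⊗ A`. -/
structure AQG (A : Type*) [NonUnitalRing A] [Module ℂ A]
    [SMulCommClass ℂ A A] [IsScalarTower ℂ A A] where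
  T1 : A ⊗[ℂ] A ≃ₗ[ℂ] A ⊗[ℂ] A
  T2 : A ⊗[ℂ] A ≃ₗ[ℂ] A ⊗[ℂ] A
  T3 : A ⊗[ℂ] A ≃ₗ[ℂ] A ⊗[ℂ] A
  T4 : A ⊗[ℂ] A ≃ₗ[ℂ] A ⊗[ℂ] A
  counit : A →ₗ[ℂ] ℂ
  S : A ≃ₗ[ℂ] A
  phi : A →ₗ[ℂ] ℂ
  rho : A ≃ₗ[ℂ] A
  ΔL : A →ₗ[ℂ] (A ⊗[ℂ] A →ₗ[ℂ] A ⊗[ℂ] A)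
  ΔR : A →ₗ[ℂ] (A ⊗[ℂ] A →ₗ[ℂ] A ⊗[ℂ] A)
  /- non-degeneracy of the algebra `A` -/
  nondeg_l : ∀ a : A, (∀ b : A, a * b = 0) → a = 0
  nondeg_r : ∀ a : A, (∀ b : A, b * a = 0) → a = 0
  /- the counit is a non-zero homomorphism with `(ε ⊙ ι)Δ = (ι ⊙ ε)Δ = ι` -/
  counit_mul : ∀ a b : A, counit (a * b) = counit a * counit b
  counit_ne : counit ≠ 0
  counit_T1 : ∀ a b : A, sliceR counit (T1 (a ⊗ₜ b)) = a * b
  counit_T2 : ∀ a b : A, sliceL counit (T2 (a ⊗ₜ b)) = a * b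
  counit_T3 : ∀ a b : A, sliceR counit (T3 (a ⊗ₜ b)) = b * a
  counit_T4 : ∀ a b : A, sliceL counit (T4 (a ⊗ₜ b)) = b * a
  /- the antipode -/
  S_mul : ∀ a b : A, S (a * b) = S b * S a
  antipode_l : ∀ a b : A,
    LinearMap.mul' ℂ A (LinearMap.rTensor A S.toLinearMap (T2 (a ⊗ₜ b))) = counit a • b
  antipode_r : ∀ a b : A,
    LinearMap.mul' ℂ A (LinearMap.lTensor A S.toLinearMap (T3 (a ⊗ₜ b))) = counit a • b
  /- `φ` is a faithful left invariant functional -/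
  phi_ne : phi ≠ 0
  phi_faithful_l : ∀ a : A, (∀ b : A, phi (a * b) = 0) → a = 0
  phi_faithful_r : ∀ a : A, (∀ b : A, phi (b * a) = 0) → a = 0
  left_inv_T1 : ∀ a b : A, sliceR phi (T1 (a ⊗ₜ b)) = phi a • b
  left_inv_T3 : ∀ a b : A, sliceR phi (T3 (a ⊗ₜ b)) = phi a • b
  /- the weak KMS automorphism `ρ`: `φ(ab) = φ(b ρ(a))` -/
  rho_mul : ∀ a b : A, rho (a * b) = rho a * rho b
  phi_kms : ∀ a b : A, phi (a * b) = phi (b * rho a)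
  /- `Δ` is a (non-degenerate) homomorphism into `M(A ⊗ A)` -/
  ΔL_mul : ∀ (a b : A) (z : A ⊗[ℂ] A), ΔL (a * b) z = ΔL a (ΔL b z)
  ΔR_mul : ∀ (a b : A) (z : A ⊗[ℂ] A), ΔR (a * b) z = ΔR b (ΔR a z)
  ΔL_assoc : ∀ (a : A) (z w : A ⊗[ℂ] A), ΔL a (z * w) = ΔL a z * w
  ΔR_assoc : ∀ (a : A) (z w : A ⊗[ℂ] A), ΔR a (z * w) = z * ΔR a w
  ΔLR : ∀ (a : A) (z w : A ⊗[ℂ] A), ΔR a z * w = z * ΔL a w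
  ΔL_T1 : ∀ (a b : A) (z : A ⊗[ℂ] A),
    T1 (a ⊗ₜ b) * z = ΔL a (TensorProduct.map (LinearMap.mulLeft ℂ b) LinearMap.id z)
  ΔL_T2 : ∀ (a b : A) (z : A ⊗[ℂ] A),
    T2 (a ⊗ₜ b) * z = ΔL a (TensorProduct.map LinearMap.id (LinearMap.mulLeft ℂ b) z)
  ΔR_T3 : ∀ (a b : A) (z : A ⊗[ℂ] A),
    z * T3 (a ⊗ₜ b) = ΔR a (TensorProduct.map (LinearMap.mulRight ℂ b) LinearMap.id z)
  ΔR_T4 : ∀ (a b : A) (z : A ⊗[ℂ] A),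
    z * T4 (a ⊗ₜ b) = ΔR a (TensorProduct.map LinearMap.id (LinearMap.mulRight ℂ b) z)
  /- coassociativity of `Δ` -/
  coassoc : ∀ a b c : A,
    (TensorProduct.assoc ℂ A A A)
        (LinearMap.rTensor A (T3.toLinearMap ∘ₗ (TensorProduct.mk ℂ A A).flip a)
          (T2 (c ⊗ₜ b)))
      = LinearMap.lTensor A (T2.toLinearMap ∘ₗ (TensorProduct.mk ℂ A A).flip b)
          (T3 (c ⊗ₜ a))

namespace AQG

variable {A : Type*} [NonUnitalRing A] [Module ℂ A]
  [SMulCommClass ℂ A A] [IsScalarTower ℂ A A] (H : AQG A)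

/-- The functional `φa : x ↦ φ(x a)`; the dual algebra is `Â = {φa : a ∈ A}`. -/
def lFun (a : A) : A →ₗ[ℂ] ℂ := H.phi ∘ₗ LinearMap.mulRight ℂ a

/-- The functional `aφ : x ↦ φ(a x)`; also `Â = {aφ : a ∈ A}`. -/
def rFun (a : A) : A →ₗ[ℂ] ℂ := H.phi ∘ₗ LinearMap.mulLeft ℂ a

/-- The right invariant functional `ψ = φ ∘ S`. -/
def psi : A →ₗ[ℂ] ℂ := H.phi ∘ₗ H.S.toLinearMap

/-- The functional `ψa : x ↦ ψ(x a)`. -/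
def lFunPsi (a : A) : A →ₗ[ℂ] ℂ := H.psi ∘ₗ LinearMap.mulRight ℂ a

/-- The right action of `Â` on `A'`: `Ract θ a = θ · (φa)`,
`(θ (φa))(x) = θ((ι ⊙ φa)Δ(x)) = θ((ι ⊙ φ)(Δ(x)(1 ⊗ a)))`. -/
def Ract (θ : A →ₗ[ℂ] ℂ) (a : A) : A →ₗ[ℂ] ℂ :=
  θ ∘ₗ sliceR H.phi ∘ₗ H.T2.toLinearMap ∘ₗ (TensorProduct.mk ℂ A A).flip a

/-- The left action of `Â` on `A'`: `Lact θ a = (φa) · θ`,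
`((φa) θ)(x) = θ((φa ⊙ ι)Δ(x)) = θ((φ ⊙ ι)(Δ(x)(a ⊗ 1)))`. -/
def Lact (θ : A →ₗ[ℂ] ℂ) (a : A) : A →ₗ[ℂ] ℂ :=
  θ ∘ₗ sliceL H.phi ∘ₗ H.T1.toLinearMap ∘ₗ (TensorProduct.mk ℂ A A).flip a

/-- `c = (ι ⊙ θ)Δ(x)` as an element of `A` (a priori it is only a multiplier). -/
def IsRSlice (θ : A →ₗ[ℂ] ℂ) (x c : A) : Prop :=
  (∀ b : A, c * b = sliceR θ (H.T1 (x ⊗ₜ b))) ∧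
  (∀ b : A, b * c = sliceR θ (H.T3 (x ⊗ₜ b)))

/-- `c = (θ ⊙ ι)Δ(x)` as an element of `A`. -/
def IsLSlice (θ : A →ₗ[ℂ] ℂ) (x c : A) : Prop :=
  (∀ b : A, c * b = sliceL θ (H.T2 (x ⊗ₜ b))) ∧
  (∀ b : A, b * c = sliceL θ (H.T4 (x ⊗ₜ b)))

/-- `θ ∈ M(Â)`: all slices `(θ ⊙ ι)Δ(x)` and `(ι ⊙ θ)Δ(x)` belong to `A`. -/
def HasSlices (θ : A →ₗ[ℂ] ℂ) : Prop :=
  ∀ x : A, (∃ c, H.IsRSlice θ x c) ∧ (∃ c, H.IsLSlice θ x c)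

end AQG

end

/-- A multiplier of the dual algebra `Â = {φa : a ∈ A}`, described by the pair of maps
`FL a = T · (φa)` and `FR a = (φa) · T`. -/
def AQG.IsMultPair {A : Type*} [NonUnitalRing A] [Module ℂ A]
    [SMulCommClass ℂ A A] [IsScalarTower ℂ A A] (H : AQG A)
    (FL FR : A → (A →ₗ[ℂ] ℂ)) : Prop :=
  (∀ a a' : A, H.lFun a = H.lFun a' → FL a = FL a' ∧ FR a = FR a') ∧
  (∀ a a' : A, FL (a + a') = FL a + FL a') ∧
  (∀ (t : ℂ) (a : A), FL (t • a) = t • FL a) ∧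
  (∀ a a' : A, FR (a + a') = FR a + FR a') ∧
  (∀ (t : ℂ) (a : A), FR (t • a) = t • FR a) ∧
  (∀ a : A, FL a ∈ Set.range H.lFun) ∧
  (∀ a : A, FR a ∈ Set.range H.lFun) ∧
  (∀ a b : A, H.Lact (FL b) a = H.Ract (FR a) b) ∧
  (∀ a b c : A, H.lFun c = H.Lact (H.lFun b) a → FL c = H.Ract (FL a) b) ∧
  (∀ a b c : A, H.lFun c = H.Lact (H.lFun b) a → FR c = H.Lact (FR b) a)


namespace AQGAux

lemma sliceL_tmul {M N : Type*} [AddCommGroup M] [Module ℂ M] [AddCommGroup N] [Module ℂ N]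
    (θ : M →ₗ[ℂ] ℂ) (x : M) (y : N) : sliceL θ (x ⊗ₜ[ℂ] y) = θ x • y := by
  simp [sliceL]

lemma sliceR_tmul {M N : Type*} [AddCommGroup M] [Module ℂ M] [AddCommGroup N] [Module ℂ N]
    (θ : N →ₗ[ℂ] ℂ) (x : M) (y : N) : sliceR θ (x ⊗ₜ[ℂ] y) = θ y • x := by
  simp [sliceR]

section gen
variable {M N P Q : Type*} [AddCommGroup M] [Module ℂ M] [AddCommGroup N] [Module ℂ N]
  [AddCommGroup P] [Module ℂ P] [AddCommGroup Q] [Module ℂ Q]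

lemma sliceL_lTensor (θ : M →ₗ[ℂ] ℂ) (f : N →ₗ[ℂ] P) (z : M ⊗[ℂ] N) :
    sliceL θ (lTensor M f z) = f (sliceL θ z) := by
  induction z with
  | zero => simp
  | tmul x y => simp [sliceL_tmul]
  | add x y hx hy => simp only [map_add, hx, hy]

lemma sliceR_rTensor (θ : N →ₗ[ℂ] ℂ) (f : M →ₗ[ℂ] P) (z : M ⊗[ℂ] N) :
    sliceR θ (rTensor N f z) = f (sliceR θ z) := by
  induction z with
  | zero => simp
  | tmul x y => simp [sliceR_tmul]
  | add x y hx hy => simp only [map_add, hx, hy]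

lemma sliceL_rTensor (θ : P →ₗ[ℂ] ℂ) (f : M →ₗ[ℂ] P) (z : M ⊗[ℂ] N) :
    sliceL θ (rTensor N f z) = sliceL (θ ∘ₗ f) z := by
  induction z with
  | zero => simp
  | tmul x y => simp [sliceL_tmul]
  | add x y hx hy => simp only [map_add, hx, hy]

lemma sliceR_lTensor (θ : P →ₗ[ℂ] ℂ) (f : N →ₗ[ℂ] P) (z : M ⊗[ℂ] N) :
    sliceR θ (lTensor M f z) = sliceR (θ ∘ₗ f) z := by
  induction z with
  | zero => simp
  | tmul x y => simp [sliceR_tmul]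
  | add x y hx hy => simp only [map_add, hx, hy]

lemma slice_swap (θ : M →ₗ[ℂ] ℂ) (η : N →ₗ[ℂ] ℂ) (z : M ⊗[ℂ] N) :
    η (sliceL θ z) = θ (sliceR η z) := by
  induction z with
  | zero => simp
  | tmul x y => simp [sliceL_tmul, sliceR_tmul, mul_comm]
  | add x y hx hy => simp only [map_add, hx, hy]

lemma eq_zero_of_sliceR (z : M ⊗[ℂ] N) (h : ∀ f : N →ₗ[ℂ] ℂ, sliceR f z = 0) : z = 0 := by
  classical
  let b := Module.Basis.ofVectorSpace ℂ N
  apply (TensorProduct.equivFinsuppOfBasisRight (M := M) b).injective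
  rw [map_zero]
  ext i
  rw [Finsupp.zero_apply, ← h (b.coord i)]
  clear h
  induction z with
  | zero => simp
  | tmul x y => simp [sliceR_tmul]
  | add x y hx hy => simp only [map_add, Finsupp.add_apply, hx, hy]

lemma eq_zero_of_sliceL (z : M ⊗[ℂ] N) (h : ∀ f : M →ₗ[ℂ] ℂ, sliceL f z = 0) : z = 0 := by
  apply eq_zero_of_sliceR
  intro f
  refine (Module.forall_dual_apply_eq_zero_iff ℂ _).1 fun g => ?_
  rw [← slice_swap, h, map_zero]

lemma rTensor_joint {ι : Type*} (g : ι → M →ₗ[ℂ] P) (hg : ∀ x, (∀ i, g i x = 0) → x = 0)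
    (z w : M ⊗[ℂ] N) (hz : ∀ i, rTensor N (g i) z = rTensor N (g i) w) : z = w := by
  rw [← sub_eq_zero]
  apply eq_zero_of_sliceR
  intro f
  apply hg
  intro i
  rw [← sliceR_rTensor, map_sub, hz, sub_self, map_zero]

lemma lTensor_joint {ι : Type*} (g : ι → N →ₗ[ℂ] P) (hg : ∀ x, (∀ i, g i x = 0) → x = 0)
    (z w : M ⊗[ℂ] N) (hz : ∀ i, lTensor M (g i) z = lTensor M (g i) w) : z = w := by
  rw [← sub_eq_zero]
  apply eq_zero_of_sliceL
  intro f
  apply hg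
  intro i
  rw [← sliceL_lTensor, map_sub, hz, sub_self, map_zero]

end gen

variable {A : Type*} [NonUnitalRing A] [Module ℂ A]
  [SMulCommClass ℂ A A] [IsScalarTower ℂ A A]

abbrev mr (d : A) : A →ₗ[ℂ] A := LinearMap.mulRight ℂ d
abbrev ml (d : A) : A →ₗ[ℂ] A := LinearMap.mulLeft ℂ d

lemma mul_tmul' (z : A ⊗[ℂ] A) (p q : A) :
    z * (p ⊗ₜ q) = rTensor A (mr p) (lTensor A (mr q) z) := by
  induction z with
  | zero => simp
  | tmul x y => simp
  | add x y hx hy => simp only [map_add, add_mul, hx, hy]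

lemma tmul_mul' (z : A ⊗[ℂ] A) (p q : A) :
    (p ⊗ₜ q) * z = rTensor A (ml p) (lTensor A (ml q) z) := by
  induction z with
  | zero => simp
  | tmul x y => simp
  | add x y hx hy => simp only [map_add, mul_add, hx, hy]

lemma rr_mul (z w : A ⊗[ℂ] A) (d : A) : rTensor A (mr d) z * w = z * rTensor A (ml d) w := by
  induction z with
  | zero => simp
  | add x y hx hy => simp only [map_add, add_mul, hx, hy]
  | tmul x y =>
  induction w with
  | zero => simp
  | tmul x y => simp [mul_assoc]
  | add x y hx hy => simp only [map_add, mul_add, hx, hy]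

lemma lr_mul (z w : A ⊗[ℂ] A) (d : A) : lTensor A (mr d) z * w = z * lTensor A (ml d) w := by
  induction z with
  | zero => simp
  | add x y hx hy => simp only [map_add, add_mul, hx, hy]
  | tmul x y =>
  induction w with
  | zero => simp
  | tmul x y => simp [mul_assoc]
  | add x y hx hy => simp only [map_add, mul_add, hx, hy]


lemma ext_r (H : AQG A) (z w : A ⊗[ℂ] A) (h : ∀ p q : A, z * (p ⊗ₜ q) = w * (p ⊗ₜ q)) : z = w := by
  apply lTensor_joint (fun q : A => mr q) (fun x hx => H.nondeg_l x hx)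
  intro q
  apply rTensor_joint (fun q : A => mr q) (fun x hx => H.nondeg_l x hx)
  intro p
  simpa [mul_tmul'] using h p q

lemma ext_l (H : AQG A) (z w : A ⊗[ℂ] A) (h : ∀ p q : A, (p ⊗ₜ q) * z = (p ⊗ₜ q) * w) : z = w := by
  apply lTensor_joint (fun q : A => ml q) (fun x hx => H.nondeg_r x hx)
  intro q
  apply rTensor_joint (fun q : A => ml q) (fun x hx => H.nondeg_r x hx)
  intro p
  simpa [tmul_mul'] using h p q

variable (H : AQG A)

lemma ΔL_eq2 (a d e : A) : H.ΔL a (d ⊗ₜ e) = rTensor A (mr d) (H.T2 (a ⊗ₜ e)) := by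
  apply ext_r H
  intro p q
  rw [← H.ΔL_assoc, rr_mul, H.ΔL_T2]
  simp

lemma ΔL_eq1 (a d e : A) : H.ΔL a (d ⊗ₜ e) = lTensor A (mr e) (H.T1 (a ⊗ₜ d)) := by
  apply ext_r H
  intro p q
  rw [← H.ΔL_assoc, lr_mul, H.ΔL_T1]
  simp

/-- `Δ(a)(d ⊗ e)`. -/
lemma T12 (a d e : A) :
    rTensor A (mr d) (H.T2 (a ⊗ₜ e)) = lTensor A (mr e) (H.T1 (a ⊗ₜ d)) := by
  rw [← ΔL_eq2, ΔL_eq1]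

lemma ΔL_T1' (a b c : A) : H.ΔL a (H.T1 (b ⊗ₜ c)) = H.T1 ((a * b) ⊗ₜ c) := by
  apply ext_r H
  intro p q
  rw [← H.ΔL_assoc, H.ΔL_T1, H.ΔL_T1, H.ΔL_mul]

lemma T1_mul (a b c : A) : H.T1 (a ⊗ₜ (b * c)) = rTensor A (mr c) (H.T1 (a ⊗ₜ b)) := by
  apply ext_r H
  intro p q
  rw [rr_mul, H.ΔL_T1, H.ΔL_T1]
  simp [mul_assoc]

lemma T2_mul (a b c : A) : H.T2 (a ⊗ₜ (b * c)) = lTensor A (mr c) (H.T2 (a ⊗ₜ b)) := by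
  apply ext_r H
  intro p q
  rw [lr_mul, H.ΔL_T2, H.ΔL_T2]
  simp [mul_assoc]

lemma T32 (a f d : A) :
    rTensor A (ml f) (H.T2 (a ⊗ₜ d)) = lTensor A (mr d) (H.T3 (a ⊗ₜ f)) := by
  apply ext_r H
  intro p q
  apply ext_l H
  intro r s
  rw [lr_mul, ← mul_assoc, ← mul_assoc, H.ΔR_T3, H.ΔLR, ← rr_mul, mul_assoc, H.ΔL_T2]
  simp

lemma T31 (a f d : A) :
    rTensor A (ml f) (H.T1 (a ⊗ₜ d)) = rTensor A (mr d) (H.T3 (a ⊗ₜ f)) := by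
  apply ext_r H
  intro p q
  apply ext_l H
  intro r s
  rw [rr_mul, ← mul_assoc, ← mul_assoc, H.ΔR_T3, H.ΔLR, ← rr_mul, mul_assoc, H.ΔL_T1]
  simp

lemma T42 (a f d : A) :
    lTensor A (ml f) (H.T2 (a ⊗ₜ d)) = lTensor A (mr d) (H.T4 (a ⊗ₜ f)) := by
  apply ext_r H
  intro p q
  apply ext_l H
  intro r s
  rw [lr_mul, ← mul_assoc, ← mul_assoc, H.ΔR_T4, H.ΔLR, ← lr_mul, mul_assoc, H.ΔL_T2]
  simp

lemma mul_span (H : AQG A) (x : A) : x ∈ Submodule.span ℂ {y : A | ∃ a b : A, y = a * b} := by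
  obtain ⟨e, he⟩ : ∃ e, H.counit e ≠ 0 := by
    by_contra! h
    exact H.counit_ne (LinearMap.ext h)
  have h1 : x = sliceR H.counit (x ⊗ₜ[ℂ] ((H.counit e)⁻¹ • e)) := by
    simp [sliceR_tmul, he]
  obtain ⟨z, hz⟩ := H.T1.surjective (x ⊗ₜ[ℂ] ((H.counit e)⁻¹ • e))
  rw [h1, ← hz]
  clear hz h1
  induction z with
  | zero => simp
  | tmul a b => rw [H.counit_T1]; exact Submodule.subset_span ⟨a, b, rfl⟩
  | add x y hx hy => rw [map_add, map_add]; exact Submodule.add_mem _ hx hy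

lemma ΔL_span (Z : A ⊗[ℂ] A) :
    Z ∈ Submodule.span ℂ {Y : A ⊗[ℂ] A | ∃ (b : A) (z : A ⊗[ℂ] A), Y = H.ΔL b z} := by
  induction Z with
  | zero => simp
  | add x y hx hy => exact Submodule.add_mem _ hx hy
  | tmul d e =>
  induction mul_span H d using Submodule.span_induction with
  | zero => simp
  | add x y _ _ hx hy => rw [add_tmul]; exact Submodule.add_mem _ hx hy
  | smul t x _ hx => rw [← smul_tmul']; exact Submodule.smul_mem _ _ hx
  | mem d hd =>
  obtain ⟨d1, d2, rfl⟩ := hd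
  induction mul_span H e using Submodule.span_induction with
  | zero => simp
  | add x y _ _ hx hy => rw [tmul_add]; exact Submodule.add_mem _ hx hy
  | smul t x _ hx => rw [tmul_smul]; exact Submodule.smul_mem _ _ hx
  | mem e he =>
  obtain ⟨e1, e2, rfl⟩ := he
  have : (d1 * d2) ⊗ₜ[ℂ] (e1 * e2) = (d1 ⊗ₜ[ℂ] e1) * (d2 ⊗ₜ[ℂ] e2) := by simp
  rw [this]
  obtain ⟨z, hz⟩ := H.T1.surjective (d1 ⊗ₜ[ℂ] e1)
  rw [← hz]
  clear hz this
  induction z with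
  | zero => simp
  | tmul a b => rw [H.ΔL_T1]; exact Submodule.subset_span ⟨a, _, rfl⟩
  | add x y hx hy => rw [map_add, add_mul]; exact Submodule.add_mem _ hx hy

/-- `d ⊗ (p ⊗ q) ↦ p₁ ⊗ (p₂ d ⊗ q)`. -/
def Th : A ⊗[ℂ] (A ⊗[ℂ] A) →ₗ[ℂ] A ⊗[ℂ] (A ⊗[ℂ] A) :=
  (TensorProduct.assoc ℂ A A A).toLinearMap ∘ₗ
    rTensor A (H.T2.toLinearMap ∘ₗ (TensorProduct.comm ℂ A A).toLinearMap) ∘ₗ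
    (TensorProduct.assoc ℂ A A A).symm.toLinearMap

/-- `d ⊗ e ↦ w₁ ⊗ (w₂ d ⊗ w₃ e)`. -/
def Kw (w : A) : A ⊗[ℂ] A →ₗ[ℂ] A ⊗[ℂ] (A ⊗[ℂ] A) :=
  Th H ∘ₗ lTensor A (H.T2.toLinearMap ∘ₗ TensorProduct.mk ℂ A A w)

def Ph : A ⊗[ℂ] (A ⊗[ℂ] A) →ₗ[ℂ] A ⊗[ℂ] A := TensorProduct.lift (H.ΔL ∘ₗ H.S.toLinearMap)

lemma rT_assoc (f : A →ₗ[ℂ] A) (z : (A ⊗[ℂ] A) ⊗[ℂ] A) :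
    rTensor (A ⊗[ℂ] A) f (TensorProduct.assoc ℂ A A A z) =
      TensorProduct.assoc ℂ A A A (rTensor A (rTensor A f) z) := by
  induction z with
  | zero => simp
  | add x y hx hy => simp only [map_add, hx, hy]
  | tmul z q =>
  induction z with
  | zero => simp
  | add x y hx hy => simp only [add_tmul, map_add, hx, hy]
  | tmul z q => simp

lemma lT_assoc (f : A →ₗ[ℂ] A) (z : (A ⊗[ℂ] A) ⊗[ℂ] A) :
    lTensor A (rTensor A f) (TensorProduct.assoc ℂ A A A z) =
      TensorProduct.assoc ℂ A A A (rTensor A (lTensor A f) z) := by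
  induction z with
  | zero => simp
  | add x y hx hy => simp only [map_add, hx, hy]
  | tmul z q =>
  induction z with
  | zero => simp
  | add x y hx hy => simp only [add_tmul, map_add, hx, hy]
  | tmul z q => simp

lemma Kw_f (w f : A) (Z : A ⊗[ℂ] A) :
    rTensor (A ⊗[ℂ] A) (ml f) (Kw H w Z) = lTensor A (H.ΔL.flip Z) (H.T3 (w ⊗ₜ f)) := by
  induction Z with
  | zero => simp
  | add x y hx hy => simp only [map_add, hx, hy, lTensor_add, LinearMap.add_apply]
  | tmul d e =>
  have h1 : H.ΔL.flip (d ⊗ₜ[ℂ] e) = rTensor A (mr d) ∘ₗ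
      (H.T2.toLinearMap ∘ₗ (TensorProduct.mk ℂ A A).flip e) := by
    ext a
    simp only [LinearMap.flip_apply, LinearMap.comp_apply, ΔL_eq2]
    rfl
  rw [h1, lTensor_comp, LinearMap.comp_apply, ← H.coassoc, lT_assoc]
  have h2 : Kw H w (d ⊗ₜ e) = Th H (d ⊗ₜ H.T2 (w ⊗ₜ e)) := by simp [Kw]
  rw [h2]
  generalize H.T2 (w ⊗ₜ[ℂ] e) = z
  induction z with
  | zero => simp
  | add x y hx hy => simp only [map_add, tmul_add, hx, hy]
  | tmul p q =>
  simp only [Th, LinearMap.comp_apply, LinearEquiv.coe_coe, TensorProduct.assoc_symm_tmul,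
    rTensor_tmul, TensorProduct.comm_tmul, rT_assoc, T32, LinearMap.flip_apply,
    TensorProduct.mk_apply]

lemma Kw_Δ (w b : A) (z : A ⊗[ℂ] A) :
    Kw H w (H.ΔL b z) = lTensor A (H.ΔL.flip z) (H.T2 (w ⊗ₜ b)) := by
  apply rTensor_joint (fun q : A => ml q) (fun x hx => H.nondeg_r x hx)
  intro f
  rw [Kw_f]
  have h1 : H.ΔL.flip (H.ΔL b z) = H.ΔL.flip z ∘ₗ mr b := by
    ext a
    simp [H.ΔL_mul]
  rw [h1, lTensor_comp, LinearMap.comp_apply, ← T32, ← LinearMap.comp_apply,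
    ← LinearMap.comp_apply, rTensor_comp_lTensor, lTensor_comp_rTensor]

lemma Ph_Kw (w : A) (Z : A ⊗[ℂ] A) : Ph H (Kw H w Z) = H.counit w • Z := by
  induction ΔL_span H Z using Submodule.span_induction with
  | zero => simp
  | add x y _ _ hx hy => simp only [map_add, hx, hy, smul_add]
  | smul t x _ hx => simp only [map_smul, hx]; rw [smul_comm]
  | mem Z hZ =>
  obtain ⟨b, z, rfl⟩ := hZ
  rw [Kw_Δ, ← LinearMap.smul_apply, ← map_smul, ← H.antipode_l]
  generalize H.T2 (w ⊗ₜ[ℂ] b) = y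
  induction y with
  | zero => simp
  | add x y hx hy => simp only [map_add, hx, hy, LinearMap.add_apply]
  | tmul p q => simp [Ph, H.ΔL_mul]

lemma Ph_Th (d p q : A) :
    Ph H (Th H (d ⊗ₜ (p ⊗ₜ q))) =
      lTensor A (mr q) (H.T1 (rTensor A H.S.toLinearMap (H.T2 (p ⊗ₜ d)))) := by
  simp only [Th, LinearMap.comp_apply, LinearEquiv.coe_coe, TensorProduct.assoc_symm_tmul,
    rTensor_tmul, TensorProduct.comm_tmul]
  generalize H.T2 (p ⊗ₜ[ℂ] d) = y
  induction y with
  | zero => simp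
  | add x y hx hy => simp only [map_add, add_tmul, hx, hy]
  | tmul u v => simp [Ph, ΔL_eq1]

/-- anti-comultiplicativity of the antipode -/
lemma anticomul (w d : A) :
    H.T1 (rTensor A H.S.toLinearMap (H.T2 (w ⊗ₜ d))) = d ⊗ₜ H.S w := by
  apply lTensor_joint (fun q : A => mr q) (fun x hx => H.nondeg_l x hx)
  intro q
  rw [← Ph_Th]
  have key : ∀ z : A ⊗[ℂ] A, Ph H (Th H (d ⊗ₜ z)) =
      d ⊗ₜ (LinearMap.mul' ℂ A (rTensor A H.S.toLinearMap z)) := by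
    intro z
    obtain ⟨y, rfl⟩ := H.T2.surjective z
    induction y with
    | zero => simp
    | add x y hx hy => simp only [map_add, tmul_add, hx, hy]
    | tmul p q =>
      rw [H.antipode_l]
      have := Ph_Kw H p (d ⊗ₜ q)
      rw [tmul_smul, ← this]
      simp [Kw]
  rw [key]
  simp

/-- right invariance of `ψ` -/
lemma psi_T2 (w d : A) : sliceL H.psi (H.T2 (w ⊗ₜ d)) = H.psi w • d := by
  have h := congrArg (sliceR H.phi) (anticomul H w d)
  rw [sliceR_tmul] at h
  change _ = H.psi w • d at h
  rw [← h]
  generalize H.T2 (w ⊗ₜ[ℂ] d) = y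
  induction y with
  | zero => simp
  | add x y hx hy => simp only [map_add, hx, hy]
  | tmul p q => simp [sliceL_tmul, H.left_inv_T1, AQG.psi]

/-- strong invariance -/
lemma strong (u y : A) :
    sliceR H.phi (H.T2 (H.S u ⊗ₜ H.S y)) = sliceL H.psi (H.T1 (y ⊗ₜ u)) := by
  rw [← sub_eq_zero]
  apply H.nondeg_l
  intro d
  rw [sub_mul, sub_eq_zero]
  have e1 : sliceR H.phi (H.T2 (H.S u ⊗ₜ H.S y)) * d =
      sliceR H.phi (H.ΔL (H.S u) (d ⊗ₜ H.S y)) := by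
    rw [ΔL_eq2, sliceR_rTensor]; rfl
  have e2 : sliceL H.psi (H.T1 (y ⊗ₜ u)) * d =
      sliceL H.psi (rTensor A (mr u) (H.T2 (y ⊗ₜ d))) := by
    rw [T12, sliceL_lTensor]; rfl
  rw [e1, e2, ← anticomul]
  generalize H.T2 (y ⊗ₜ[ℂ] d) = y
  induction y with
  | zero => simp
  | add x y hx hy => simp only [map_add, hx, hy]
  | tmul p q => simp [sliceL_tmul, H.left_inv_T1, AQG.psi, ΔL_T1', H.S_mul]


def Lm (a : A) : A →ₗ[ℂ] A :=
  sliceL H.phi ∘ₗ H.T1.toLinearMap ∘ₗ (TensorProduct.mk ℂ A A).flip a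

def Rm (a : A) : A →ₗ[ℂ] A :=
  sliceR H.phi ∘ₗ H.T2.toLinearMap ∘ₗ (TensorProduct.mk ℂ A A).flip a

lemma Lm_apply (a x : A) : Lm H a x = sliceL H.phi (H.T1 (x ⊗ₜ a)) := rfl
lemma Rm_apply (a x : A) : Rm H a x = sliceR H.phi (H.T2 (x ⊗ₜ a)) := rfl
lemma Lact_eq (θ : A →ₗ[ℂ] ℂ) (a : A) : H.Lact θ a = θ ∘ₗ Lm H a := rfl
lemma Ract_eq (θ : A →ₗ[ℂ] ℂ) (a : A) : H.Ract θ a = θ ∘ₗ Rm H a := rfl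
lemma Lact_apply (θ : A →ₗ[ℂ] ℂ) (a x : A) : H.Lact θ a x = θ (Lm H a x) := rfl
lemma Ract_apply (θ : A →ₗ[ℂ] ℂ) (a x : A) : H.Ract θ a x = θ (Rm H a x) := rfl
lemma lFun_apply (a x : A) : H.lFun a x = H.phi (x * a) := rfl
lemma lFunPsi_apply (a x : A) : H.lFunPsi a x = H.phi (H.S (x * a)) := rfl
lemma psi_apply (x : A) : H.psi x = H.phi (H.S x) := rfl

lemma eq_of_mul_r (H : AQG A) {x y : A} (h : ∀ d, x * d = y * d) : x = y := by
  rw [← sub_eq_zero]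
  apply H.nondeg_l
  intro d
  rw [sub_mul, h, sub_self]

lemma eq_of_mul_l (H : AQG A) {x y : A} (h : ∀ d, d * x = d * y) : x = y := by
  rw [← sub_eq_zero]
  apply H.nondeg_r
  intro d
  rw [mul_sub, h, sub_self]

lemma lFun_inj {a b : A} (h : H.lFun a = H.lFun b) : a = b := by
  rw [← sub_eq_zero]
  apply H.phi_faithful_r
  intro d
  have := LinearMap.congr_fun h d
  simp only [lFun_apply] at this
  rw [mul_sub, map_sub, this, sub_self]

lemma Lm_mul (a x d : A) : Lm H a x * d = sliceL (H.lFun a) (H.T2 (x ⊗ₜ d)) := by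
  have : Lm H a x * d = sliceL H.phi (lTensor A (mr d) (H.T1 (x ⊗ₜ a))) := by
    rw [sliceL_lTensor]; rfl
  rw [this, ← T12, sliceL_rTensor]; rfl

lemma psi_mul (u x d : A) :
    sliceL H.psi (H.T1 (x ⊗ₜ u)) * d = sliceL (H.lFunPsi u) (H.T2 (x ⊗ₜ d)) := by
  have : sliceL H.psi (H.T1 (x ⊗ₜ u)) * d =
      sliceL H.psi (lTensor A (mr d) (H.T1 (x ⊗ₜ u))) := by
    rw [sliceL_lTensor]; rfl
  rw [this, ← T12, sliceL_rTensor]; rfl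

lemma mul_Rm (b x d : A) : d * Rm H b x = sliceR (H.lFun b) (H.T3 (x ⊗ₜ d)) := by
  have : d * Rm H b x = sliceR H.phi (rTensor A (ml d) (H.T2 (x ⊗ₜ b))) := by
    rw [sliceR_rTensor]; rfl
  rw [this, T32, sliceR_lTensor]; rfl

lemma Lm_alt (a x : A) : Lm H a x = sliceL H.phi (H.T3 (x ⊗ₜ H.rho.symm a)) := by
  apply eq_of_mul_r H
  intro d
  have : sliceL H.phi (H.T3 (x ⊗ₜ H.rho.symm a)) * d =
      sliceL H.phi (lTensor A (mr d) (H.T3 (x ⊗ₜ H.rho.symm a))) := by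
    rw [sliceL_lTensor]; rfl
  rw [Lm_mul, this, ← T32, sliceL_rTensor]
  congr 1
  congr 1
  ext y
  simp [lFun_apply, H.phi_kms (H.rho.symm a) y]

lemma sliceL_assoc (θ : A →ₗ[ℂ] ℂ) (z : (A ⊗[ℂ] A) ⊗[ℂ] A) :
    sliceL θ (TensorProduct.assoc ℂ A A A z) = rTensor A (sliceL θ) z := by
  induction z with
  | zero => simp
  | add x y hx hy => simp only [map_add, hx, hy]
  | tmul z q =>
  induction z with
  | zero => simp
  | add x y hx hy => simp only [add_tmul, map_add, hx, hy]
  | tmul z q => simp [sliceL_tmul, smul_tmul']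

lemma sliceR_assoc (θ : A →ₗ[ℂ] ℂ) (z : (A ⊗[ℂ] A) ⊗[ℂ] A) :
    lTensor A (sliceR θ) (TensorProduct.assoc ℂ A A A z) = sliceR θ z := by
  induction z with
  | zero => simp
  | add x y hx hy => simp only [map_add, hx, hy]
  | tmul z q =>
  induction z with
  | zero => simp
  | add x y hx hy => simp only [add_tmul, map_add, hx, hy]
  | tmul z q => simp [sliceR_tmul]

lemma T3_Rm (v x d : A) :
    H.T3 (Rm H v x ⊗ₜ d) = lTensor A (Rm H v) (H.T3 (x ⊗ₜ d)) := by
  have h := congrArg (lTensor A (sliceR H.phi)) (H.coassoc d v x)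
  rw [sliceR_assoc, sliceR_rTensor, ← LinearMap.comp_apply (lTensor A _), ← lTensor_comp] at h
  exact h

lemma T2_Lm (a x d : A) :
    H.T2 (Lm H a x ⊗ₜ d) = rTensor A (Lm H a) (H.T2 (x ⊗ₜ d)) := by
  have h := congrArg (sliceL H.phi) (H.coassoc (H.rho.symm a) d x)
  rw [sliceL_assoc, sliceL_lTensor, ← Lm_alt, ← LinearMap.comp_apply (rTensor A _),
    ← rTensor_comp] at h
  have e : Lm H a = sliceL H.phi ∘ₗ H.T3.toLinearMap ∘ₗ
      (TensorProduct.mk ℂ A A).flip (H.rho.symm a) := by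
    ext y
    exact Lm_alt H a y
  rw [e] at h ⊢
  exact h.symm

lemma LR_comm (a b x : A) : Lm H a (Rm H b x) = Rm H b (Lm H a x) := by
  rw [Rm_apply, Rm_apply, T2_Lm, sliceR_rTensor]

lemma slice_R_Rm (θ : A →ₗ[ℂ] ℂ) (v w x d : A) (h : H.Ract θ v = H.lFun w) :
    d * Rm H w x = sliceR θ (H.T3 (Rm H v x ⊗ₜ d)) := by
  rw [T3_Rm, sliceR_lTensor, ← Ract_eq, h, mul_Rm]

lemma slice_L_Lm (θ : A →ₗ[ℂ] ℂ) (v w x d : A) (h : H.Lact θ v = H.lFun w) :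
    Lm H w x * d = sliceL θ (H.T2 (Lm H v x ⊗ₜ d)) := by
  rw [T2_Lm, sliceL_rTensor, ← Lact_eq, h, Lm_mul]

lemma act_swap (a b : A) : H.Lact (H.lFun b) a = H.Ract (H.lFun a) b := by
  ext x
  rw [Lact_apply, lFun_apply, Lm_mul, slice_swap, Ract_apply, Rm_apply]

lemma Rm_mul_of (a b c x : A) (h : H.lFun c = H.Lact (H.lFun b) a) :
    Rm H c x = Rm H a (Rm H b x) := by
  apply eq_of_mul_l H
  intro d
  rw [act_swap] at h
  rw [slice_R_Rm H (H.lFun a) b c x d h.symm, mul_Rm]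

lemma Lm_mul_of (a b c x : A) (h : H.lFun c = H.Lact (H.lFun b) a) :
    Lm H c x = Lm H b (Lm H a x) := by
  apply eq_of_mul_r H
  intro d
  rw [slice_L_Lm H (H.lFun b) a c x d h.symm, Lm_mul]

lemma phi_psi_aux (z z' : A ⊗[ℂ] A) (h : H.T2 z = H.T1 z') :
    H.lFunPsi (sliceR H.phi z) = H.lFun (sliceR H.psi z') := by
  ext x
  have h2 : H.psi (sliceR H.phi (H.ΔL x (H.T2 z))) = H.lFunPsi (sliceR H.phi z) x := by
    clear h
    induction z with
    | zero => simp [lFunPsi_apply]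
    | add p q hp hq => simp only [map_add, hp, hq, lFunPsi_apply, mul_add]
    | tmul p q =>
      have : H.ΔL x (H.T2 (p ⊗ₜ q)) = H.T2 ((x * p) ⊗ₜ q) := by
        apply ext_r H
        intro r s
        rw [← H.ΔL_assoc, H.ΔL_T2, H.ΔL_T2, H.ΔL_mul]
      rw [this, ← slice_swap, psi_T2, sliceR_tmul, lFunPsi_apply]
      simp [psi_apply, mul_comm, mul_smul_comm]
  have h1 : H.psi (sliceR H.phi (H.ΔL x (H.T1 z'))) = H.lFun (sliceR H.psi z') x := by
    clear h
    induction z' with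
    | zero => simp [lFun_apply]
    | add p q hp hq => simp only [map_add, hp, hq, lFun_apply, mul_add]
    | tmul p q =>
      rw [ΔL_T1', H.left_inv_T1, sliceR_tmul, lFun_apply]
      simp [psi_apply, mul_comm, mul_smul_comm]
  rw [← h1, ← h2, h]

lemma exists_phi_one : ∃ e, H.phi e = 1 := by
  obtain ⟨e, he⟩ : ∃ e, H.phi e ≠ 0 := by
    by_contra! h
    exact H.phi_ne (LinearMap.ext h)
  exact ⟨(H.phi e)⁻¹ • e, by simp [he]⟩

lemma lFun_psi (a : A) : ∃ u, H.lFun a = H.lFunPsi u := by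
  obtain ⟨e, he⟩ := exists_phi_one H
  have h := phi_psi_aux H (H.T2.symm (H.T1 (a ⊗ₜ H.S.symm e))) (a ⊗ₜ H.S.symm e) (by simp)
  rw [sliceR_tmul, psi_apply, LinearEquiv.apply_symm_apply, he, one_smul] at h
  exact ⟨_, h.symm⟩

lemma psi_lFun (u : A) : ∃ a, H.lFun a = H.lFunPsi u := by
  obtain ⟨e, he⟩ := exists_phi_one H
  have h := phi_psi_aux H (u ⊗ₜ e) (H.T1.symm (H.T2 (u ⊗ₜ e))) (by simp)
  rw [sliceR_tmul, he, one_smul] at h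
  exact ⟨_, h.symm⟩

lemma Ract_S (θ : A →ₗ[ℂ] ℂ) (x u : A) :
    H.Ract θ (H.S x) (H.S u) = H.psi (sliceR θ (H.T1 (x ⊗ₜ u))) := by
  rw [Ract_apply, Rm_apply, strong, ← slice_swap]

lemma Lact_S (θ : A →ₗ[ℂ] ℂ) (a u y : A) (h : H.lFun a = H.lFunPsi u) :
    H.Lact θ a y = H.phi (sliceL θ (H.T2 (H.S u ⊗ₜ H.S y))) := by
  have : Lm H a y = sliceL H.psi (H.T1 (y ⊗ₜ u)) := by
    apply eq_of_mul_r H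
    intro d
    rw [Lm_mul, psi_mul, h]
  rw [Lact_apply, this, ← strong, ← slice_swap]

lemma Ract_mem (θ : A →ₗ[ℂ] ℂ) (x c : A) (h : H.IsRSlice θ x c) :
    H.Ract θ (H.S x) = H.lFun (H.S c) := by
  ext y
  obtain ⟨u, rfl⟩ := H.S.surjective y
  rw [Ract_S, ← h.1, lFun_apply, psi_apply, H.S_mul]

lemma Lact_mem (θ : A →ₗ[ℂ] ℂ) (a u c : A) (h : H.lFun a = H.lFunPsi u)
    (hc : H.IsLSlice θ (H.S u) c) : H.Lact θ a = H.lFunPsi (H.S.symm c) := by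
  ext y
  rw [Lact_S H θ a u y h, ← hc.1, lFunPsi_apply, H.S_mul, LinearEquiv.apply_symm_apply]

lemma RSlice_of (θ : A →ₗ[ℂ] ℂ) (x c : A) (h : H.Ract θ (H.S x) = H.lFun (H.S c)) :
    H.IsRSlice θ x c := by
  have h1 : ∀ b : A, c * b = sliceR θ (H.T1 (x ⊗ₜ b)) := by
    intro b
    rw [← sub_eq_zero]
    apply H.S.injective
    rw [map_zero]
    apply H.phi_faithful_r
    intro y
    obtain ⟨u, rfl⟩ := H.S.surjective y
    rw [← H.S_mul, sub_mul, map_sub, map_sub]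
    have e : sliceR θ (H.T1 (x ⊗ₜ b)) * u = sliceR θ (H.T1 (x ⊗ₜ (b * u))) := by
      rw [T1_mul, sliceR_rTensor]; rfl
    rw [e, ← psi_apply H (sliceR θ _), ← Ract_S, h, lFun_apply, ← H.S_mul, mul_assoc, sub_self]
  refine ⟨h1, fun b => ?_⟩
  apply eq_of_mul_r H
  intro y
  rw [mul_assoc, h1]
  have e1 : b * sliceR θ (H.T1 (x ⊗ₜ y)) = sliceR θ (rTensor A (ml b) (H.T1 (x ⊗ₜ y))) := by
    rw [sliceR_rTensor]; rfl
  rw [e1, T31, sliceR_rTensor]; rfl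

lemma LSlice_of (θ : A →ₗ[ℂ] ℂ) (a u g : A) (h : H.lFun a = H.lFunPsi u)
    (hg : H.Lact θ a = H.lFunPsi g) : H.IsLSlice θ (H.S u) (H.S g) := by
  have h1 : ∀ b : A, H.S g * b = sliceL θ (H.T2 (H.S u ⊗ₜ b)) := by
    intro b
    rw [← sub_eq_zero]
    apply H.phi_faithful_l
    intro y
    have e : sliceL θ (H.T2 (H.S u ⊗ₜ b)) * y = sliceL θ (H.T2 (H.S u ⊗ₜ (b * y))) := by
      rw [T2_mul, sliceL_lTensor]; rfl
    rw [sub_mul, map_sub, e, mul_assoc]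
    obtain ⟨v, hv⟩ := H.S.surjective (b * y)
    rw [← hv, ← Lact_S H θ a u v h, hg, lFunPsi_apply, H.S_mul, sub_self]
  refine ⟨h1, fun b => ?_⟩
  apply eq_of_mul_r H
  intro y
  rw [mul_assoc, h1]
  have e1 : b * sliceL θ (H.T2 (H.S u ⊗ₜ y)) =
      sliceL θ (lTensor A (ml b) (H.T2 (H.S u ⊗ₜ y))) := by
    rw [sliceL_lTensor]; rfl
  rw [e1, T42, sliceL_lTensor]; rfl

lemma Ract_range (θ : A →ₗ[ℂ] ℂ) (h : H.HasSlices θ) (a : A) :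
    ∃ d, H.lFun d = H.Ract θ a := by
  obtain ⟨c, hc⟩ := (h (H.S.symm a)).1
  have := Ract_mem H θ _ c hc
  rw [LinearEquiv.apply_symm_apply] at this
  exact ⟨_, this.symm⟩

lemma Lact_range (θ : A →ₗ[ℂ] ℂ) (h : H.HasSlices θ) (a : A) :
    ∃ d, H.lFun d = H.Lact θ a := by
  obtain ⟨u, hu⟩ := lFun_psi H a
  obtain ⟨c, hc⟩ := (h (H.S u)).2
  rw [Lact_mem H θ a u c hu hc]
  exact psi_lFun H _

lemma Lm_surj (x : A) : ∃ z, sliceL H.phi (H.T1 z) = x := by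
  obtain ⟨e, he⟩ := exists_phi_one H
  exact ⟨H.T1.symm (e ⊗ₜ x), by simp [sliceL_tmul, he]⟩

lemma Rm_surj (x : A) : ∃ z, sliceR H.phi (H.T2 z) = x := by
  obtain ⟨e, he⟩ := exists_phi_one H
  exact ⟨H.T2.symm (x ⊗ₜ e), by simp [sliceR_tmul, he]⟩

lemma Lm_ext (f g : A →ₗ[ℂ] ℂ) (h : ∀ a x, f (Lm H a x) = g (Lm H a x)) : f = g := by
  ext x
  obtain ⟨z, rfl⟩ := Lm_surj H x
  induction z with
  | zero => simp
  | add p q hp hq => simp only [map_add, hp, hq]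
  | tmul p q => exact h q p

lemma mult_of_slices (θ : A →ₗ[ℂ] ℂ) (h : H.HasSlices θ) :
    H.IsMultPair (fun a => H.Ract θ a) (fun a => H.Lact θ a) := by
  refine ⟨fun a a' e => ?_, fun a a' => ?_, fun t a => ?_, fun a a' => ?_, fun t a => ?_,
    Ract_range H θ h, Lact_range H θ h, fun a b => ?_, fun a b c e => ?_, fun a b c e => ?_⟩
  · rw [lFun_inj H e]; exact ⟨rfl, rfl⟩
  · ext x; simp [Ract_apply, Rm_apply, tmul_add]
  · ext x; simp [Ract_apply, Rm_apply]
  · ext x; simp [Lact_apply, Lm_apply, tmul_add]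
  · ext x; simp [Lact_apply, Lm_apply]
  · ext x; simp only [Lact_apply, Ract_apply, LR_comm]
  · ext x; simp only [Ract_apply, Rm_mul_of H a b c _ e]
  · ext x; simp only [Lact_apply, Lm_mul_of H a b c _ e]

lemma counit_Lm (c x : A) : H.counit (Lm H c x) = H.lFun c x := by
  rw [Lm_apply, slice_swap, H.counit_T1, lFun_apply]

lemma exists_theta (FL FR : A → (A →ₗ[ℂ] ℂ)) (h : H.IsMultPair FL FR) :
    ∃ θ, H.HasSlices θ ∧ (∀ a, H.Ract θ a = FL a) ∧ (∀ a, H.Lact θ a = FR a) := by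
  obtain ⟨-, -, -, hRa, hRs, hLr, hRr, hm, -, -⟩ := h
  choose c hc using hRr
  have hca : ∀ a a', c (a + a') = c a + c a' := by
    intro a a'
    apply lFun_inj H
    rw [hc, hRa, ← hc, ← hc]
    ext x; simp [lFun_apply, mul_add]
  have hcs : ∀ (t : ℂ) a, c (t • a) = t • c a := by
    intro t a
    apply lFun_inj H
    rw [hc, hRs, ← hc]
    ext x; simp [lFun_apply, mul_smul_comm]
  let cl : A →ₗ[ℂ] A := ⟨⟨c, hca⟩, hcs⟩
  let L : A ⊗[ℂ] A →ₗ[ℂ] A := sliceL H.phi ∘ₗ H.T1.toLinearMap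
  let K : A ⊗[ℂ] A →ₗ[ℂ] ℂ := H.counit ∘ₗ L ∘ₗ lTensor A cl
  have hK : ∀ a x, K (x ⊗ₜ a) = FR a x := by
    intro a x
    have : K (x ⊗ₜ a) = H.counit (Lm H (c a) x) := rfl
    rw [this, counit_Lm, hc]
  have hker : ∀ z, L z = 0 → K z = 0 := by
    intro z hz
    have : L (lTensor A cl z) = 0 := by
      apply H.phi_faithful_l
      intro b
      have e : ∀ z, H.phi (L (lTensor A cl z) * b) = FL b (L z) := by
        intro z
        induction z with
        | zero => simp
        | add p q hp hq => simp only [map_add, add_mul, hp, hq]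
        | tmul x a =>
          have e1 : H.phi (L (lTensor A cl (x ⊗ₜ a)) * b) =
            H.Lact (H.lFun b) (c a) x := rfl
          rw [e1, act_swap, hc, ← hm]; rfl
      rw [e, hz, map_zero]
    change H.counit (L (lTensor A cl z)) = 0
    rw [this, map_zero]
  obtain ⟨σ, hσ⟩ := L.exists_rightInverse_of_surjective
    (LinearMap.range_eq_top.2 (Lm_surj H))
  have hθ : ∀ z, K (σ (L z)) = K z := by
    intro z
    rw [← sub_eq_zero, ← map_sub]
    apply hker
    rw [map_sub, sub_eq_zero]
    exact LinearMap.congr_fun hσ (L z)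
  have hL : ∀ a, H.Lact (K ∘ₗ σ) a = FR a := by
    intro a
    ext x
    rw [← hK, ← hθ]; rfl
  have hR : ∀ a, H.Ract (K ∘ₗ σ) a = FL a := by
    intro b
    apply Lm_ext H
    intro a x
    rw [Ract_apply, ← LR_comm, ← Lact_apply, hL, ← Ract_apply, ← hm]; rfl
  refine ⟨K ∘ₗ σ, fun x => ⟨?_, ?_⟩, hR, hL⟩
  · obtain ⟨d, hd⟩ := hLr (H.S x)
    refine ⟨H.S.symm d, RSlice_of H _ _ _ ?_⟩
    rw [hR, LinearEquiv.apply_symm_apply, hd]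
  · obtain ⟨a, ha⟩ := psi_lFun H (H.S.symm x)
    obtain ⟨g, hg⟩ := lFun_psi H (c a)
    have := LSlice_of H (K ∘ₗ σ) a _ g ha (by rw [hL, ← hc, hg])
    rw [LinearEquiv.apply_symm_apply] at this
    exact ⟨_, this⟩

lemma product_formula (θ₁ θ₂ : A →ₗ[ℂ] ℂ) (h₁ : H.HasSlices θ₁) (h₂ : H.HasSlices θ₂)
    (a c c' : A) (hc : ∀ b, b * c = sliceR θ₂ (H.T3 (a ⊗ₜ b)))
    (hc' : ∀ b, c' * b = sliceL θ₁ (H.T2 (a ⊗ₜ b))) : θ₁ c = θ₂ c' := by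
  suffices hs : ∃ c c' : A, (∀ b, b * c = sliceR θ₂ (H.T3 (a ⊗ₜ b))) ∧
      (∀ b, c' * b = sliceL θ₁ (H.T2 (a ⊗ₜ b))) ∧ θ₁ c = θ₂ c' by
    obtain ⟨d, d', hd, hd', e⟩ := hs
    have e1 : c = d := eq_of_mul_l H fun b => by rw [hc, hd]
    have e2 : c' = d' := eq_of_mul_r H fun b => by rw [hc', hd']
    rw [e1, e2, e]
  clear hc hc' c c'
  obtain ⟨z, rfl⟩ := Lm_surj H a
  induction z with
  | zero => exact ⟨0, 0, by simp⟩
  | add p q hp hq =>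
    obtain ⟨c, c', i1, i2, i3⟩ := hp
    obtain ⟨d, d', j1, j2, j3⟩ := hq
    exact ⟨c + d, c' + d', fun b => by simp only [mul_add, i1, j1, map_add, add_tmul],
      fun b => by simp only [add_mul, i2, j2, map_add, add_tmul], by rw [map_add, map_add, i3, j3]⟩
  | tmul x u =>
    change ∃ c c' : A, (∀ b, b * c = sliceR θ₂ (H.T3 (Lm H u x ⊗ₜ b))) ∧
      (∀ b, c' * b = sliceL θ₁ (H.T2 (Lm H u x ⊗ₜ b))) ∧ θ₁ c = θ₂ c'
    obtain ⟨z, rfl⟩ := Rm_surj H x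
    induction z with
    | zero => exact ⟨0, 0, by simp⟩
    | add p q hp hq =>
      obtain ⟨c, c', i1, i2, i3⟩ := hp
      obtain ⟨d, d', j1, j2, j3⟩ := hq
      exact ⟨c + d, c' + d', fun b => by simp only [mul_add, i1, j1, map_add, add_tmul],
        fun b => by simp only [add_mul, i2, j2, map_add, add_tmul],
        by rw [map_add, map_add, i3, j3]⟩
    | tmul y v =>
      obtain ⟨w, hw⟩ := Ract_range H θ₂ h₂ v
      obtain ⟨w', hw'⟩ := Lact_range H θ₁ h₁ u
      refine ⟨Rm H w (Lm H u y), Lm H w' (Rm H v y), fun b => ?_, fun b => ?_, ?_⟩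
      · rw [slice_R_Rm H θ₂ v w _ b hw.symm, ← LR_comm]; rfl
      · rw [slice_L_Lm H θ₁ u w' _ b hw'.symm]; rfl
      · rw [← LR_comm, ← Lact_apply, ← hw', LR_comm, ← Ract_apply H θ₂, ← hw,
          ← Ract_apply, ← Lact_apply, act_swap]

end AQGAux

/-- `M(Â)` is (linearly) isomorphic to
`{θ ∈ A' ∣ all slices of θ lie in A}`: the map `θ ↦ (θ·(φ·), (φ·)·θ)` is a bijection
onto the multipliers of `Â`; the product is given by
`(θ₁θ₂)(a) = θ₁((ι ⊙ θ₂)Δ(a)) = θ₂((θ₁ ⊙ ι)Δ(a))`, and `ε` is the unit of `M(Â)`. -/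
theorem AQG.multiplier_algebra_implementation {A : Type*} [NonUnitalRing A]
    [Module ℂ A] [SMulCommClass ℂ A A] [IsScalarTower ℂ A A] (H : AQG A) :
    -- the implementation map is a bijection onto the multipliers of `Â`
    Set.BijOn (fun θ : A →ₗ[ℂ] ℂ => ((fun a => H.Ract θ a), (fun a => H.Lact θ a)))
        {θ | H.HasSlices θ} {p | H.IsMultPair p.1 p.2} ∧
    -- the two product formulas agree
    (∀ θ₁ θ₂ : A →ₗ[ℂ] ℂ, H.HasSlices θ₁ → H.HasSlices θ₂ →
      ∀ a c c' : A, H.IsRSlice θ₂ a c → H.IsLSlice θ₁ a c' → θ₁ c = θ₂ c') ∧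
    -- `ε ∈ M(Â)` and `ε` is the unit: its slices are the identity
    (∀ a : A, H.IsRSlice H.counit a a ∧ H.IsLSlice H.counit a a) := by
  refine ⟨⟨fun θ h => AQGAux.mult_of_slices H θ h, fun θ₁ _ θ₂ _ e => ?_, fun p hp => ?_⟩,
    fun θ₁ θ₂ h₁ h₂ a c c' hc hc' => AQGAux.product_formula H θ₁ θ₂ h₁ h₂ a c c' hc.2 hc'.1,
    fun a => ⟨⟨fun b => (H.counit_T1 a b).symm, fun b => (H.counit_T3 a b).symm⟩,
      ⟨fun b => (H.counit_T2 a b).symm, fun b => (H.counit_T4 a b).symm⟩⟩⟩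
  · apply AQGAux.Lm_ext H
    intro a x
    exact LinearMap.congr_fun (congrFun (congrArg Prod.snd e) a) x
  · obtain ⟨θ, h, hR, hL⟩ := AQGAux.exists_theta H p.1 p.2 hp
    exact ⟨θ, h, Prod.ext (funext hR) (funext hL)⟩
end

section
/- Let (A,Δ) be an algebraic quantum group and θ ∈ A'. Then θ belongs to M(Â) (i.e., both slices (θ⊙ι)Δ(a) and (ι⊙θ)Δ(a) lie in A for all a ∈ A) if and only if θω ∈ Â and ωθ ∈ Â for every ω ∈ Â. -/
open TensorProduct LinearMap

open TensorProduct LinearMap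
set_option linter.unusedSectionVars false
set_option linter.unusedSimpArgs false
namespace AQG
section gen
variable {M N : Type*} [AddCommGroup M] [Module ℂ M] [AddCommGroup N] [Module ℂ N]

@[simp] lemma sliceL_tmul (θ : M →ₗ[ℂ] ℂ) (x : M) (y : N) : sliceL θ (x ⊗ₜ[ℂ] y) = θ x • y := by
  simp [sliceL]
@[simp] lemma sliceR_tmul (θ : N →ₗ[ℂ] ℂ) (x : M) (y : N) : sliceR θ (x ⊗ₜ[ℂ] y) = θ y • x := by
  simp [sliceR]

open Classical in
lemma sep_L (z : M ⊗[ℂ] N) (h : ∀ f : M →ₗ[ℂ] ℂ, sliceL f z = 0) : z = 0 := by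
  let b := Module.Basis.ofVectorSpace ℂ M
  apply (TensorProduct.equivFinsuppOfBasisLeft (N := N) b).injective
  rw [map_zero]
  ext i
  have h1 := h (b.coord i)
  have : ∀ z : M ⊗[ℂ] N, TensorProduct.equivFinsuppOfBasisLeft (N := N) b z i = sliceL (b.coord i) z := by
    intro z
    induction z with
    | zero => simp
    | tmul x y => simp
    | add x y hx hy => simp [hx, hy]
  rw [this, h1]; rfl

lemma sep_R (z : M ⊗[ℂ] N) (h : ∀ f : N →ₗ[ℂ] ℂ, sliceR f z = 0) : z = 0 := by
  apply (TensorProduct.comm ℂ M N).injective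
  rw [map_zero]
  apply sep_L
  intro f
  rw [← h f]
  clear h
  induction z with
  | zero => simp
  | tmul x y => simp
  | add x y hx hy => simp [hx, hy]
end gen

section main
variable {A : Type*} [NonUnitalRing A] [Module ℂ A]
  [SMulCommClass ℂ A A] [IsScalarTower ℂ A A] (H : AQG A)
variable {M : Type*} [AddCommGroup M] [Module ℂ M]

/-- left multiplication on the first leg -/
abbrev L1 (M : Type*) [AddCommGroup M] [Module ℂ M] (b : A) : A ⊗[ℂ] M →ₗ[ℂ] A ⊗[ℂ] M :=
  TensorProduct.map (LinearMap.mulLeft ℂ b) LinearMap.id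
/-- right multiplication on the first leg -/
abbrev R1 (M : Type*) [AddCommGroup M] [Module ℂ M] (b : A) : A ⊗[ℂ] M →ₗ[ℂ] A ⊗[ℂ] M :=
  TensorProduct.map (LinearMap.mulRight ℂ b) LinearMap.id
/-- left multiplication on the second leg -/
abbrev L2 (M : Type*) [AddCommGroup M] [Module ℂ M] (b : A) : M ⊗[ℂ] A →ₗ[ℂ] M ⊗[ℂ] A :=
  TensorProduct.map LinearMap.id (LinearMap.mulLeft ℂ b)
/-- right multiplication on the second leg -/
abbrev R2 (M : Type*) [AddCommGroup M] [Module ℂ M] (b : A) : M ⊗[ℂ] A →ₗ[ℂ] M ⊗[ℂ] A :=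
  TensorProduct.map LinearMap.id (LinearMap.mulRight ℂ b)

lemma sliceL_R2 (f : M →ₗ[ℂ] ℂ) (b : A) (z : M ⊗[ℂ] A) : sliceL f (R2 M b z) = sliceL f z * b := by
  induction z with
  | zero => simp
  | tmul x y => simp [smul_mul_assoc]
  | add x y hx hy => simp only [map_add, hx, hy, add_mul]
lemma sliceL_L2 (f : M →ₗ[ℂ] ℂ) (b : A) (z : M ⊗[ℂ] A) : sliceL f (L2 M b z) = b * sliceL f z := by
  induction z with
  | zero => simp
  | tmul x y => simp [mul_smul_comm]
  | add x y hx hy => simp only [map_add, hx, hy, mul_add]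
lemma sliceR_R1 (f : M →ₗ[ℂ] ℂ) (b : A) (z : A ⊗[ℂ] M) : sliceR f (R1 M b z) = sliceR f z * b := by
  induction z with
  | zero => simp
  | tmul x y => simp [smul_mul_assoc]
  | add x y hx hy => simp only [map_add, hx, hy, add_mul]
lemma sliceR_L1 (f : M →ₗ[ℂ] ℂ) (b : A) (z : A ⊗[ℂ] M) : sliceR f (L1 M b z) = b * sliceR f z := by
  induction z with
  | zero => simp
  | tmul x y => simp [mul_smul_comm]
  | add x y hx hy => simp only [map_add, hx, hy, mul_add]

lemma ext_R2 (H : AQG A) {z w : M ⊗[ℂ] A} (h : ∀ b, R2 M b z = R2 M b w) : z = w := by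
  rw [← sub_eq_zero]
  refine sep_L _ fun f => H.nondeg_l _ fun b => ?_
  rw [← sliceL_R2, map_sub, h, sub_self, map_zero]
lemma ext_L2 (H : AQG A) {z w : M ⊗[ℂ] A} (h : ∀ b, L2 M b z = L2 M b w) : z = w := by
  rw [← sub_eq_zero]
  refine sep_L _ fun f => H.nondeg_r _ fun b => ?_
  rw [← sliceL_L2, map_sub, h, sub_self, map_zero]
lemma ext_R1 (H : AQG A) {z w : A ⊗[ℂ] M} (h : ∀ b, R1 M b z = R1 M b w) : z = w := by
  rw [← sub_eq_zero]
  refine sep_R _ fun f => H.nondeg_l _ fun b => ?_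
  rw [← sliceR_R1, map_sub, h, sub_self, map_zero]
lemma ext_L1 (H : AQG A) {z w : A ⊗[ℂ] M} (h : ∀ b, L1 M b z = L1 M b w) : z = w := by
  rw [← sub_eq_zero]
  refine sep_R _ fun f => H.nondeg_r _ fun b => ?_
  rw [← sliceR_L1, map_sub, h, sub_self, map_zero]

lemma mul_tmul' (z : A ⊗[ℂ] A) (b c : A) : z * (b ⊗ₜ c) = R1 A b (R2 A c z) := by
  induction z with
  | zero => simp
  | tmul x y => simp
  | add x y hx hy => simp only [map_add, hx, hy, add_mul]
lemma tmul_mul' (z : A ⊗[ℂ] A) (b c : A) : (b ⊗ₜ c) * z = L1 A b (L2 A c z) := by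
  induction z with
  | zero => simp
  | tmul x y => simp
  | add x y hx hy => simp only [map_add, hx, hy, mul_add]

lemma ext_r (H : AQG A) {z w : A ⊗[ℂ] A} (h : ∀ u, z * u = w * u) : z = w := by
  refine H.ext_R2 fun c => H.ext_R1 fun b => ?_
  rw [← mul_tmul', ← mul_tmul', h]
lemma ext_l (H : AQG A) {z w : A ⊗[ℂ] A} (h : ∀ u, u * z = u * w) : z = w := by
  refine H.ext_L2 fun c => H.ext_L1 fun b => ?_
  rw [← tmul_mul', ← tmul_mul', h]

lemma R1_mul (b : A) (z w : A ⊗[ℂ] A) : R1 A b z * w = z * L1 A b w := by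
  induction w with
  | zero => simp
  | add x y hx hy => simp only [map_add, hx, hy, mul_add]
  | tmul x y =>
    induction z with
    | zero => simp
    | tmul x y => simp [mul_assoc]
    | add x y hx hy => simp only [map_add, hx, hy, add_mul]
lemma R2_mul (b : A) (z w : A ⊗[ℂ] A) : R2 A b z * w = z * L2 A b w := by
  induction w with
  | zero => simp
  | add x y hx hy => simp only [map_add, hx, hy, mul_add]
  | tmul x y =>
    induction z with
    | zero => simp
    | tmul x y => simp [mul_assoc]
    | add x y hx hy => simp only [map_add, hx, hy, add_mul]
lemma L1_mul (b : A) (z w : A ⊗[ℂ] A) : L1 A b z * w = L1 A b (z * w) := by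
  induction w with
  | zero => simp
  | add x y hx hy => simp only [map_add, hx, hy, mul_add]
  | tmul x y =>
    induction z with
    | zero => simp
    | tmul x y => simp [mul_assoc]
    | add x y hx hy => simp only [map_add, hx, hy, add_mul]
lemma L2_mul (b : A) (z w : A ⊗[ℂ] A) : L2 A b z * w = L2 A b (z * w) := by
  induction w with
  | zero => simp
  | add x y hx hy => simp only [map_add, hx, hy, mul_add]
  | tmul x y =>
    induction z with
    | zero => simp
    | tmul x y => simp [mul_assoc]
    | add x y hx hy => simp only [map_add, hx, hy, add_mul]
lemma mul_R1 (b : A) (z w : A ⊗[ℂ] A) : z * R1 A b w = R1 A b (z * w) := by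
  induction w with
  | zero => simp
  | add x y hx hy => simp only [map_add, hx, hy, mul_add]
  | tmul x y =>
    induction z with
    | zero => simp
    | tmul x y => simp [mul_assoc]
    | add x y hx hy => simp only [map_add, hx, hy, add_mul]
lemma mul_R2 (b : A) (z w : A ⊗[ℂ] A) : z * R2 A b w = R2 A b (z * w) := by
  induction w with
  | zero => simp
  | add x y hx hy => simp only [map_add, hx, hy, mul_add]
  | tmul x y =>
    induction z with
    | zero => simp
    | tmul x y => simp [mul_assoc]
    | add x y hx hy => simp only [map_add, hx, hy, add_mul]

lemma L1_L2 (b c : A) (z : A ⊗[ℂ] A) : L1 A b (L2 A c z) = L2 A c (L1 A b z) := by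
  induction z with
  | zero => simp
  | tmul x y => simp
  | add x y hx hy => simp only [map_add, hx, hy]
lemma R1_R2 (b c : A) (z : A ⊗[ℂ] A) : R1 A b (R2 A c z) = R2 A c (R1 A b z) := by
  induction z with
  | zero => simp
  | tmul x y => simp
  | add x y hx hy => simp only [map_add, hx, hy]

lemma dL1 (a b : A) (z : A ⊗[ℂ] A) : H.T1 (a ⊗ₜ b) * z = H.ΔL a (L1 A b z) := H.ΔL_T1 a b z
lemma dL2 (a b : A) (z : A ⊗[ℂ] A) : H.T2 (a ⊗ₜ b) * z = H.ΔL a (L2 A b z) := H.ΔL_T2 a b z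
lemma dR3 (a b : A) (z : A ⊗[ℂ] A) : z * H.T3 (a ⊗ₜ b) = H.ΔR a (R1 A b z) := H.ΔR_T3 a b z
lemma dR4 (a b : A) (z : A ⊗[ℂ] A) : z * H.T4 (a ⊗ₜ b) = H.ΔR a (R2 A b z) := H.ΔR_T4 a b z

lemma c1 (a b d : A) : R2 A d (H.T1 (a ⊗ₜ b)) = R1 A b (H.T2 (a ⊗ₜ d)) := by
  refine H.ext_r fun u => ?_
  rw [R2_mul, R1_mul, dL1, dL2, L1_L2]
lemma c2 (a b d : A) : L2 A d (H.T3 (a ⊗ₜ b)) = L1 A b (H.T4 (a ⊗ₜ d)) := by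
  refine H.ext_l fun u => ?_
  rw [← R2_mul, ← R1_mul, dR3, dR4, R1_R2]
lemma c3 (a b p : A) : L1 A p (H.T1 (a ⊗ₜ b)) = R1 A b (H.T3 (a ⊗ₜ p)) := by
  refine H.ext_l fun u => H.ext_r fun v => ?_
  rw [← R1_mul, mul_assoc, mul_assoc, R1_mul b, ← mul_assoc u, dL1, dR3, H.ΔLR]
lemma c4 (a b p : A) : L2 A p (H.T2 (a ⊗ₜ b)) = R2 A b (H.T4 (a ⊗ₜ p)) := by
  refine H.ext_l fun u => H.ext_r fun v => ?_
  rw [← R2_mul, mul_assoc, mul_assoc, R2_mul b, ← mul_assoc u, dL2, dR4, H.ΔLR]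
lemma c5 (a b p : A) : L1 A p (H.T2 (a ⊗ₜ b)) = R2 A b (H.T3 (a ⊗ₜ p)) := by
  refine H.ext_l fun u => H.ext_r fun v => ?_
  rw [← R1_mul, mul_assoc, mul_assoc, R2_mul b, ← mul_assoc u, dL2, dR3, H.ΔLR]
lemma c6 (a b p : A) : L2 A p (H.T1 (a ⊗ₜ b)) = R1 A b (H.T4 (a ⊗ₜ p)) := by
  refine H.ext_l fun u => H.ext_r fun v => ?_
  rw [← R2_mul, mul_assoc, mul_assoc, R1_mul b, ← mul_assoc u, dL1, dR4, H.ΔLR]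

lemma T2_mul (a b s : A) : H.T2 (a ⊗ₜ (b * s)) = R2 A s (H.T2 (a ⊗ₜ b)) := by
  refine H.ext_r fun u => ?_
  rw [R2_mul, dL2, dL2]
  congr 1
  induction u with
  | zero => simp
  | tmul x y => simp [mul_assoc]
  | add x y hx hy => simp only [map_add, hx, hy]
lemma T1_mul (a b s : A) : H.T1 (a ⊗ₜ (b * s)) = R1 A s (H.T1 (a ⊗ₜ b)) := by
  refine H.ext_r fun u => ?_
  rw [R1_mul, dL1, dL1]
  congr 1
  induction u with
  | zero => simp
  | tmul x y => simp [mul_assoc]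
  | add x y hx hy => simp only [map_add, hx, hy]
lemma T3_mul (a b s : A) : H.T3 (a ⊗ₜ (s * b)) = L1 A s (H.T3 (a ⊗ₜ b)) := by
  refine H.ext_l fun u => ?_
  rw [← R1_mul, dR3, dR3]
  congr 1
  induction u with
  | zero => simp
  | tmul x y => simp [mul_assoc]
  | add x y hx hy => simp only [map_add, hx, hy]
lemma T4_mul (a b s : A) : H.T4 (a ⊗ₜ (s * b)) = L2 A s (H.T4 (a ⊗ₜ b)) := by
  refine H.ext_l fun u => ?_
  rw [← R2_mul, dR4, dR4]
  congr 1
  induction u with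
  | zero => simp
  | tmul x y => simp [mul_assoc]
  | add x y hx hy => simp only [map_add, hx, hy]

lemma ΔL_T2' (v : A) (z : A ⊗[ℂ] A) : H.ΔL v (H.T2 z) = H.T2 (L1 A v z) := by
  induction z with
  | zero => simp
  | add x y hx hy => simp only [map_add, hx, hy]
  | tmul x y =>
    refine H.ext_r fun u => ?_
    simp only [TensorProduct.map_tmul, LinearMap.mulLeft_apply, LinearMap.id_apply]
    rw [← H.ΔL_assoc, dL2, dL2, H.ΔL_mul]
lemma ΔL_T1' (v : A) (z : A ⊗[ℂ] A) : H.ΔL v (H.T1 z) = H.T1 (L1 A v z) := by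
  induction z with
  | zero => simp
  | add x y hx hy => simp only [map_add, hx, hy]
  | tmul x y =>
    refine H.ext_r fun u => ?_
    simp only [TensorProduct.map_tmul, LinearMap.mulLeft_apply, LinearMap.id_apply]
    rw [← H.ΔL_assoc, dL1, dL1, H.ΔL_mul]
lemma ΔR_T3' (v : A) (z : A ⊗[ℂ] A) : H.ΔR v (H.T3 z) = H.T3 (R1 A v z) := by
  induction z with
  | zero => simp
  | add x y hx hy => simp only [map_add, hx, hy]
  | tmul x y =>
    refine H.ext_l fun u => ?_
    simp only [TensorProduct.map_tmul, LinearMap.mulRight_apply, LinearMap.id_apply]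
    rw [← H.ΔR_assoc, dR3, dR3, H.ΔR_mul]
lemma ΔL_tmul (v u s : A) : H.ΔL v (u ⊗ₜ s) = R2 A s (H.T1 (v ⊗ₜ u)) := by
  refine H.ext_r fun w => ?_
  rw [R2_mul, dL1, ← H.ΔL_assoc, tmul_mul']
lemma ΔR_tmul (v u s : A) : H.ΔR v (s ⊗ₜ u) = L1 A s (H.T4 (v ⊗ₜ u)) := by
  refine H.ext_l fun w => ?_
  rw [← R1_mul, dR4, ← H.ΔR_assoc, mul_tmul', R1_R2]

/-- `x ↦ T (x ⊗ a)` -/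
abbrev col (T : A ⊗[ℂ] A ≃ₗ[ℂ] A ⊗[ℂ] A) (a : A) : A →ₗ[ℂ] A ⊗[ℂ] A :=
  T.toLinearMap ∘ₗ (TensorProduct.mk ℂ A A).flip a

lemma col_apply (T : A ⊗[ℂ] A ≃ₗ[ℂ] A ⊗[ℂ] A) (a x : A) : col T a x = T (x ⊗ₜ a) := rfl

lemma coassoc0 (a b c : A) :
    (TensorProduct.assoc ℂ A A A) (LinearMap.rTensor A (col H.T3 a) (H.T2 (c ⊗ₜ b)))
      = LinearMap.lTensor A (col H.T2 b) (H.T3 (c ⊗ₜ a)) := H.coassoc a b c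

lemma g1 (g : A →ₗ[ℂ] A ⊗[ℂ] A) (b : A) (z : A ⊗[ℂ] A) :
    R2 (A ⊗[ℂ] A) b (LinearMap.rTensor A g z) = LinearMap.rTensor A g (R2 A b z) := by
  induction z with
  | zero => simp
  | tmul x y => simp
  | add x y hx hy => simp only [map_add, hx, hy]
lemma g2 (g : A →ₗ[ℂ] A ⊗[ℂ] A) (b : A) (z : A ⊗[ℂ] A) :
    L2 (A ⊗[ℂ] A) b (LinearMap.rTensor A g z) = LinearMap.rTensor A g (L2 A b z) := by
  induction z with
  | zero => simp
  | tmul x y => simp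
  | add x y hx hy => simp only [map_add, hx, hy]
lemma g3 (g : A →ₗ[ℂ] A ⊗[ℂ] A) (b : A) (z : A ⊗[ℂ] A) :
    L1 (A ⊗[ℂ] A) b (LinearMap.lTensor A g z) = LinearMap.lTensor A g (L1 A b z) := by
  induction z with
  | zero => simp
  | tmul x y => simp
  | add x y hx hy => simp only [map_add, hx, hy]
lemma g4 (g : A →ₗ[ℂ] A ⊗[ℂ] A) (b : A) (z : A ⊗[ℂ] A) :
    R1 (A ⊗[ℂ] A) b (LinearMap.lTensor A g z) = LinearMap.lTensor A g (R1 A b z) := by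
  induction z with
  | zero => simp
  | tmul x y => simp
  | add x y hx hy => simp only [map_add, hx, hy]
lemma g5 (b : A) (w : (A ⊗[ℂ] A) ⊗[ℂ] A) :
    L1 (A ⊗[ℂ] A) b (TensorProduct.assoc ℂ A A A w)
      = TensorProduct.assoc ℂ A A A (LinearMap.rTensor A (L1 A b) w) := by
  have : (L1 (A ⊗[ℂ] A) b) ∘ₗ (TensorProduct.assoc ℂ A A A).toLinearMap
      = (TensorProduct.assoc ℂ A A A).toLinearMap ∘ₗ (LinearMap.rTensor A (L1 A b)) := by
    apply TensorProduct.ext_threefold; intro x y z; simp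
  exact LinearMap.congr_fun this w
lemma g6 (b : A) (w : (A ⊗[ℂ] A) ⊗[ℂ] A) :
    R1 (A ⊗[ℂ] A) b (TensorProduct.assoc ℂ A A A w)
      = TensorProduct.assoc ℂ A A A (LinearMap.rTensor A (R1 A b) w) := by
  have : (R1 (A ⊗[ℂ] A) b) ∘ₗ (TensorProduct.assoc ℂ A A A).toLinearMap
      = (TensorProduct.assoc ℂ A A A).toLinearMap ∘ₗ (LinearMap.rTensor A (R1 A b)) := by
    apply TensorProduct.ext_threefold; intro x y z; simp
  exact LinearMap.congr_fun this w
lemma g7 (b : A) (w : (A ⊗[ℂ] A) ⊗[ℂ] A) :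
    TensorProduct.assoc ℂ A A A (R2 (A ⊗[ℂ] A) b w)
      = LinearMap.lTensor A (R2 A b) (TensorProduct.assoc ℂ A A A w) := by
  have : (TensorProduct.assoc ℂ A A A).toLinearMap ∘ₗ (R2 (A ⊗[ℂ] A) b) 
      = (LinearMap.lTensor A (R2 A b)) ∘ₗ (TensorProduct.assoc ℂ A A A).toLinearMap := by
    apply TensorProduct.ext_threefold; intro x y z; simp
  exact LinearMap.congr_fun this w
lemma g8 (b : A) (w : (A ⊗[ℂ] A) ⊗[ℂ] A) :
    TensorProduct.assoc ℂ A A A (L2 (A ⊗[ℂ] A) b w)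
      = LinearMap.lTensor A (L2 A b) (TensorProduct.assoc ℂ A A A w) := by
  have : (TensorProduct.assoc ℂ A A A).toLinearMap ∘ₗ (L2 (A ⊗[ℂ] A) b) 
      = (LinearMap.lTensor A (L2 A b)) ∘ₗ (TensorProduct.assoc ℂ A A A).toLinearMap := by
    apply TensorProduct.ext_threefold; intro x y z; simp
  exact LinearMap.congr_fun this w

lemma coassoc4 (a r c : A) :
    (TensorProduct.assoc ℂ A A A) (LinearMap.rTensor A (col H.T3 a) (H.T4 (c ⊗ₜ r)))
      = LinearMap.lTensor A (col H.T4 r) (H.T3 (c ⊗ₜ a)) := by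
  rw [← LinearEquiv.eq_symm_apply]
  refine H.ext_R2 fun b => ?_
  apply (TensorProduct.assoc ℂ A A A).injective
  rw [g1, ← c4, ← g2, g8, coassoc0, g7, LinearEquiv.apply_symm_apply,
    ← LinearMap.lTensor_comp_apply, ← LinearMap.lTensor_comp_apply]
  congr 2
  ext x
  simp only [LinearMap.comp_apply]
  exact H.c4 x b r

lemma coassoc1 (a b c : A) :
    (TensorProduct.assoc ℂ A A A) (LinearMap.rTensor A (col H.T1 a) (H.T2 (c ⊗ₜ b)))
      = LinearMap.lTensor A (col H.T2 b) (H.T1 (c ⊗ₜ a)) := by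
  refine H.ext_L1 fun p => ?_
  rw [g3, c3, ← g4, ← coassoc0, g5, g6,
    ← LinearMap.rTensor_comp_apply, ← LinearMap.rTensor_comp_apply]
  congr 3
  ext x
  simp only [LinearMap.comp_apply]
  exact H.c3 x a p

/-- `m (ι ⊗ S)` -/
abbrev mS : A ⊗[ℂ] A →ₗ[ℂ] A := LinearMap.mul' ℂ A ∘ₗ LinearMap.lTensor A H.S.toLinearMap
/-- `m (S ⊗ ι)` -/
abbrev Sm : A ⊗[ℂ] A →ₗ[ℂ] A := LinearMap.mul' ℂ A ∘ₗ LinearMap.rTensor A H.S.toLinearMap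

lemma mS_L1 (q : A) (z : A ⊗[ℂ] A) : H.mS (L1 A q z) = q * H.mS z := by
  induction z with
  | zero => simp
  | tmul x y => simp [mul_assoc]
  | add x y hx hy => simp only [map_add, hx, hy, mul_add]
lemma mS_L2 (q : A) (z : A ⊗[ℂ] A) : H.mS (L2 A q z) = H.mS z * H.S q := by
  induction z with
  | zero => simp
  | tmul x y => simp [mul_assoc, H.S_mul]
  | add x y hx hy => simp only [map_add, hx, hy, add_mul]
lemma Sm_R2 (q : A) (z : A ⊗[ℂ] A) : H.Sm (R2 A q z) = H.Sm z * q := by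
  induction z with
  | zero => simp
  | tmul x y => simp [mul_assoc]
  | add x y hx hy => simp only [map_add, hx, hy, add_mul]
lemma Sm_R1 (q : A) (z : A ⊗[ℂ] A) : H.Sm (R1 A q z) = H.S q * H.Sm z := by
  induction z with
  | zero => simp
  | tmul x y => simp [mul_assoc, H.S_mul]
  | add x y hx hy => simp only [map_add, hx, hy, mul_add]

lemma cancel_l (H : AQG A) {x y : A} (h : ∀ b, b * x = b * y) : x = y := by
  rw [← sub_eq_zero]
  refine H.nondeg_r _ fun b => ?_
  rw [mul_sub, h, sub_self]
lemma cancel_r (H : AQG A) {x y : A} (h : ∀ b, x * b = y * b) : x = y := by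
  rw [← sub_eq_zero]
  refine H.nondeg_l _ fun b => ?_
  rw [sub_mul, h, sub_self]

lemma mS_T4 (x u : A) : H.mS (H.T4 (x ⊗ₜ u)) = H.counit x • H.S u := by
  refine H.cancel_l fun q => ?_
  have h : H.mS (H.T3 (x ⊗ₜ q)) = H.counit x • q := H.antipode_r x q
  rw [← mS_L1, ← c2, mS_L2, h, smul_mul_assoc, mul_smul_comm]
lemma Sm_T1 (x u : A) : H.Sm (H.T1 (x ⊗ₜ u)) = H.counit x • H.S u := by
  refine H.cancel_r fun q => ?_
  have h : H.Sm (H.T2 (x ⊗ₜ q)) = H.counit x • q := H.antipode_l x q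
  rw [← Sm_R2, c1, Sm_R1, h, smul_mul_assoc, mul_smul_comm]

/-- `ι ⊗ S` -/
abbrev iS : A ⊗[ℂ] A →ₗ[ℂ] A ⊗[ℂ] A := LinearMap.lTensor A H.S.toLinearMap
/-- `S ⊗ ι` -/
abbrev Si : A ⊗[ℂ] A →ₗ[ℂ] A ⊗[ℂ] A := LinearMap.rTensor A H.S.toLinearMap
/-- flip -/
abbrev fl : A ⊗[ℂ] A →ₗ[ℂ] A ⊗[ℂ] A := (TensorProduct.comm ℂ A A).toLinearMap

lemma IV (v u : A) : H.T2 (H.iS (H.T4 (v ⊗ₜ u))) = v ⊗ₜ H.S u := by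
  refine H.ext_L1 fun p => ?_
  have h1 : ∀ z : A ⊗[ℂ] A, L1 A p (H.T2 (H.iS z)) =
      LinearMap.lTensor A H.mS (TensorProduct.assoc ℂ A A A (LinearMap.rTensor A (col H.T3 p) z)) := by
    intro z
    induction z with
    | zero => simp
    | add x y hx hy => simp only [map_add, hx, hy]
    | tmul x y =>
      simp only [LinearMap.lTensor_tmul, LinearMap.rTensor_tmul, col_apply, LinearEquiv.coe_coe]
      rw [c5]
      generalize H.T3 (x ⊗ₜ[ℂ] p) = w
      induction w with
      | zero => simp
      | tmul x y => simp
      | add x y hx hy => simp only [map_add, hx, hy, TensorProduct.add_tmul]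
  rw [h1, coassoc4, ← LinearMap.lTensor_comp_apply]
  have h2 : H.mS ∘ₗ col H.T4 u = LinearMap.toSpanSingleton ℂ A (H.S u) ∘ₗ H.counit := by
    ext x
    simp only [LinearMap.comp_apply]
    exact H.mS_T4 x u
  rw [h2]
  have h3 : ∀ z : A ⊗[ℂ] A, LinearMap.lTensor A (LinearMap.toSpanSingleton ℂ A (H.S u) ∘ₗ H.counit) z
     = sliceR H.counit z ⊗ₜ H.S u := by
    intro z
    induction z with
    | zero => simp
    | add x y hx hy => simp only [map_add, hx, hy, TensorProduct.add_tmul]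
    | tmul x y => simp [TensorProduct.smul_tmul]
  rw [h3, H.counit_T3]
  simp

lemma IV' (v u : A) : H.T3 (H.iS (fl (H.T1 (v ⊗ₜ u)))) = H.S u ⊗ₜ v := by
  refine H.ext_R2 fun d => ?_
  have h1 : ∀ z : A ⊗[ℂ] A, R2 A d (H.T3 (H.iS (fl z))) =
      LinearMap.rTensor A H.Sm ((TensorProduct.assoc ℂ A A A).symm (LinearMap.lTensor A (col H.T2 d) z)) := by
    intro z
    induction z with
    | zero => simp
    | add x y hx hy => simp only [map_add, hx, hy]
    | tmul x y =>
      simp only [LinearMap.lTensor_tmul, LinearMap.rTensor_tmul, col_apply, LinearEquiv.coe_coe,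
        TensorProduct.comm_tmul]
      rw [← c5]
      generalize H.T2 (y ⊗ₜ[ℂ] d) = w
      induction w with
      | zero => simp
      | tmul x y => simp
      | add x y hx hy => simp only [map_add, hx, hy, TensorProduct.tmul_add]
  rw [h1, ← coassoc1, LinearEquiv.symm_apply_apply, ← LinearMap.rTensor_comp_apply]
  have h2 : H.Sm ∘ₗ col H.T1 u = LinearMap.toSpanSingleton ℂ A (H.S u) ∘ₗ H.counit := by
    ext x
    simp only [LinearMap.comp_apply]
    exact H.Sm_T1 x u
  rw [h2]
  have h3 : ∀ z : A ⊗[ℂ] A, LinearMap.rTensor A (LinearMap.toSpanSingleton ℂ A (H.S u) ∘ₗ H.counit) z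
     = H.S u ⊗ₜ sliceL H.counit z := by
    intro z
    induction z with
    | zero => simp
    | add x y hx hy => simp only [map_add, hx, hy, TensorProduct.tmul_add]
    | tmul x y => simp [TensorProduct.smul_tmul]
  rw [h3, H.counit_T2]
  simp

lemma T2_iS_L2 (r : A) (z : A ⊗[ℂ] A) : H.T2 (H.iS (L2 A r z)) = R2 A (H.S r) (H.T2 (H.iS z)) := by
  induction z with
  | zero => simp
  | add x y hx hy => simp only [map_add, hx, hy]
  | tmul x y => simp [H.S_mul, T2_mul]
lemma T3_iS_R1 (r : A) (z : A ⊗[ℂ] A) :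
    H.T3 (H.iS (fl (R1 A r z))) = L1 A (H.S r) (H.T3 (H.iS (fl z))) := by
  induction z with
  | zero => simp
  | add x y hx hy => simp only [map_add, hx, hy]
  | tmul x y => simp [H.S_mul, T3_mul]

lemma I (u v : A) : H.T2 (H.iS (H.T3 (u ⊗ₜ v))) = H.T1 (v ⊗ₜ u) := by
  refine H.ext_R2 fun s => ?_
  obtain ⟨r, rfl⟩ := H.S.surjective s
  have h : ∀ z : A ⊗[ℂ] A, H.iS (L1 A v z) = L1 A v (H.iS z) := by
    intro z
    induction z with
    | zero => simp
    | add x y hx hy => simp only [map_add, hx, hy]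
    | tmul x y => simp
  rw [← T2_iS_L2, c2, h, ← ΔL_T2', IV, ΔL_tmul]

lemma I' (u v : A) : H.T3 (H.iS (fl (H.T2 (u ⊗ₜ v)))) = H.T4 (v ⊗ₜ u) := by
  refine H.ext_L1 fun s => ?_
  obtain ⟨r, rfl⟩ := H.S.surjective s
  have h : ∀ z : A ⊗[ℂ] A, H.iS (fl (R2 A v z)) = R1 A v (H.iS (fl z)) := by
    intro z
    induction z with
    | zero => simp
    | add x y hx hy => simp only [map_add, hx, hy]
    | tmul x y => simp
  rw [← T3_iS_R1, ← c1, h, ← ΔR_T3', IV', ΔR_tmul]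

lemma I_gen (z : A ⊗[ℂ] A) : H.T2 (H.iS (H.T3 z)) = H.T1 (fl z) := by
  induction z with
  | zero => simp
  | add x y hx hy => simp only [map_add, hx, hy]
  | tmul x y => rw [I]; simp
lemma I'_gen (z : A ⊗[ℂ] A) : H.T3 (H.iS (fl (H.T2 z))) = H.T4 (fl z) := by
  induction z with
  | zero => simp
  | add x y hx hy => simp only [map_add, hx, hy]
  | tmul x y => rw [I']; simp
lemma fl_iS_fl (z : A ⊗[ℂ] A) : fl (H.iS (fl z)) = H.Si z := by
  induction z with
  | zero => simp
  | add x y hx hy => simp only [map_add, hx, hy]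
  | tmul x y => simp
lemma fl_fl (z : A ⊗[ℂ] A) : fl (fl z) = z := by
  induction z with
  | zero => simp
  | add x y hx hy => simp only [map_add, hx, hy]
  | tmul x y => simp

lemma III (y d : A) : H.T1 (H.Si (H.T2 (y ⊗ₜ d))) = d ⊗ₜ H.S y := by
  rw [← fl_iS_fl, ← I_gen, I', IV]

lemma EE (y b : A) : H.T2 (H.S b ⊗ₜ H.S y) = H.T1 (H.Si (H.T1 (y ⊗ₜ b))) := by
  rw [← fl_iS_fl, ← I_gen, IV']; simp

lemma EE' (y b : A) : H.T3 (H.S b ⊗ₜ H.S y) = H.T4 (fl (H.iS (H.T4 (y ⊗ₜ b)))) := by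
  rw [← I'_gen, IV]; simp

lemma sR_T1 (z : A ⊗[ℂ] A) : sliceR H.phi (H.T1 z) = sliceL H.phi z := by
  induction z with
  | zero => simp
  | add x y hx hy => simp only [map_add, hx, hy]
  | tmul x y => rw [H.left_inv_T1]; simp
lemma sL_Si (z : A ⊗[ℂ] A) : sliceL H.phi (H.Si z) = sliceL H.psi z := by
  induction z with
  | zero => simp
  | add x y hx hy => simp only [map_add, hx, hy]
  | tmul x y => simp [psi]

lemma psi_T2 (y d : A) : sliceL H.psi (H.T2 (y ⊗ₜ d)) = H.psi y • d := by
  rw [← sL_Si, ← sR_T1, III]; simp [psi]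
lemma psi_T4 (y d : A) : sliceL H.psi (H.T4 (y ⊗ₜ d)) = H.psi y • d := by
  refine H.cancel_r fun b => ?_
  rw [← sliceL_R2, ← c4, sliceL_L2, psi_T2, smul_mul_assoc, mul_smul_comm]
lemma sL_T4 (z : A ⊗[ℂ] A) : sliceL H.psi (H.T4 z) = sliceL H.psi z := by
  induction z with
  | zero => simp
  | add x y hx hy => simp only [map_add, hx, hy]
  | tmul x y => rw [psi_T4]; simp

lemma E (y b : A) : sliceR H.phi (H.T2 (H.S b ⊗ₜ H.S y)) = sliceL H.psi (H.T1 (y ⊗ₜ b)) := by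
  rw [EE, sR_T1, sL_Si]

lemma E' (y b : A) : sliceL H.psi (H.T3 (H.S b ⊗ₜ H.S y))
    = sliceR (H.psi ∘ₗ H.S.toLinearMap) (H.T4 (y ⊗ₜ b)) := by
  rw [EE', sL_T4]
  generalize H.T4 (y ⊗ₜ[ℂ] b) = z
  induction z with
  | zero => simp
  | add x y hx hy => simp only [map_add, hx, hy]
  | tmul x y => simp

lemma swap (f g : A →ₗ[ℂ] ℂ) (z : A ⊗[ℂ] A) : f (sliceL g z) = g (sliceR f z) := by
  induction z with
  | zero => simp
  | add x y hx hy => simp only [map_add, hx, hy]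
  | tmul x y => simp [mul_comm]

lemma psi_ext {x y : A} (h : ∀ b, H.psi (x * b) = H.psi (y * b)) : x = y := by
  apply H.S.injective
  rw [← sub_eq_zero]
  refine H.phi_faithful_r _ fun b => ?_
  obtain ⟨b, rfl⟩ := H.S.surjective b
  have := h b
  simp only [psi, LinearMap.comp_apply, LinearEquiv.coe_coe, H.S_mul] at this
  rw [mul_sub, map_sub, this, sub_self]

lemma psiS_ext {x y : A} (h : ∀ b, H.psi (H.S (b * x)) = H.psi (H.S (b * y))) : x = y := by
  apply H.S.injective
  refine H.psi_ext fun b => ?_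
  obtain ⟨b, rfl⟩ := H.S.surjective b
  rw [← H.S_mul, ← H.S_mul, h]

lemma R_iff (θ : A →ₗ[ℂ] ℂ) (y : A) :
    (∃ c, H.IsRSlice θ y c) ↔ H.Ract θ (H.S y) ∈ Set.range H.lFun := by
  have key : ∀ b, H.Ract θ (H.S y) (H.S b) = H.psi (sliceR θ (H.T1 (y ⊗ₜ b))) := by
    intro b
    rw [← swap, ← E]
    rfl
  have key2 : ∀ b c, H.lFun (H.S c) (H.S b) = H.psi (c * b) := by
    intro b c
    simp [lFun, psi, H.S_mul]
  constructor
  · rintro ⟨c, h, -⟩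
    refine ⟨H.S c, ?_⟩
    ext x
    obtain ⟨b, rfl⟩ := H.S.surjective x
    rw [key, key2, h]
  · rintro ⟨c, h⟩
    obtain ⟨c, rfl⟩ := H.S.surjective c
    have h0 : ∀ b, H.psi (c * b) = H.psi (sliceR θ (H.T1 (y ⊗ₜ b))) := by
      intro b
      rw [← key, ← key2, h]
    have h1 : ∀ b, c * b = sliceR θ (H.T1 (y ⊗ₜ b)) := by
      intro b
      refine H.psi_ext fun d => ?_
      rw [mul_assoc, h0, T1_mul, sliceR_R1]
    refine ⟨c, h1, fun b => H.cancel_r fun d => ?_⟩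
    rw [mul_assoc, h1, ← sliceR_L1, ← sliceR_R1, c3]

/-- `ψ(c ·)` -/
abbrev rPsi (c : A) : A →ₗ[ℂ] ℂ := H.psi ∘ₗ LinearMap.mulLeft ℂ c
/-- the action `θ((ψ(a ·) ⊗ ι)Δ(x))` -/
abbrev Lam (θ : A →ₗ[ℂ] ℂ) (a : A) : A →ₗ[ℂ] ℂ :=
  θ ∘ₗ sliceL H.psi ∘ₗ col H.T3 a

lemma L_iff (θ : A →ₗ[ℂ] ℂ) (y : A) :
    (∃ c, H.IsLSlice θ y c) ↔ H.Lam θ (H.S y) ∈ Set.range H.rPsi := by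
  have key : ∀ b, H.Lam θ (H.S y) (H.S b) = H.psi (H.S (sliceL θ (H.T4 (y ⊗ₜ b)))) := by
    intro b
    have := swap (H.psi ∘ₗ H.S.toLinearMap) θ (H.T4 (y ⊗ₜ b))
    rw [← E'] at this
    exact this.symm
  have key2 : ∀ b c, H.rPsi (H.S c) (H.S b) = H.psi (H.S (b * c)) := by
    intro b c
    simp [H.S_mul]
  constructor
  · rintro ⟨c, -, h⟩
    refine ⟨H.S c, ?_⟩
    ext x
    obtain ⟨b, rfl⟩ := H.S.surjective x
    rw [key, key2, h]
  · rintro ⟨c, h⟩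
    obtain ⟨c, rfl⟩ := H.S.surjective c
    have h0 : ∀ b, H.psi (H.S (b * c)) = H.psi (H.S (sliceL θ (H.T4 (y ⊗ₜ b)))) := by
      intro b
      rw [← key, ← key2, h]
    have h1 : ∀ b, b * c = sliceL θ (H.T4 (y ⊗ₜ b)) := by
      intro b
      refine H.psiS_ext fun d => ?_
      rw [← mul_assoc, h0, T4_mul, sliceL_L2]
    refine ⟨c, fun b => H.cancel_l fun d => ?_, h1⟩
    rw [← mul_assoc, h1, ← sliceL_L2, ← sliceL_R2, c4]

lemma twoway (x : A) (z : A ⊗[ℂ] A) :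
    H.psi (x * sliceR H.phi (H.T2.symm z)) = H.phi (x * sliceR H.psi (H.T1.symm z)) := by
  have hA : ∀ w, H.phi (sliceL H.psi (H.ΔL x (H.T2 w))) = H.psi (x * sliceR H.phi w) := by
    intro w
    rw [ΔL_T2']
    induction w with
    | zero => simp
    | add x y hx hy => simp only [map_add, hx, hy, mul_add]
    | tmul p q => simp [psi_T2, mul_smul_comm, mul_comm]
  have hB : ∀ w, H.phi (sliceL H.psi (H.ΔL x (H.T1 w))) = H.phi (x * sliceR H.psi w) := by
    intro w
    rw [swap, ΔL_T1', sR_T1]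
    induction w with
    | zero => simp
    | add x y hx hy => simp only [map_add, hx, hy, mul_add]
    | tmul p q => simp [mul_smul_comm, mul_comm]
  rw [← hA, ← hB, LinearEquiv.apply_symm_apply, LinearEquiv.apply_symm_apply]

lemma sliceR_surj (f : A →ₗ[ℂ] ℂ) (hf : f ≠ 0) (a : A) : ∃ z : A ⊗[ℂ] A, sliceR f z = a := by
  obtain ⟨b, hb⟩ : ∃ b, f b ≠ 0 := by
    by_contra! h
    exact hf (LinearMap.ext h)
  refine ⟨((f b)⁻¹ • a) ⊗ₜ b, ?_⟩
  rw [sliceR_tmul, smul_inv_smul₀ hb]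

lemma psi_ne : H.psi ≠ 0 := by
  intro h
  apply H.phi_ne
  ext x
  obtain ⟨b, rfl⟩ := H.S.surjective x
  exact LinearMap.congr_fun h b

lemma phi_to_psi (a : A) : ∃ b, ∀ x, H.phi (x * a) = H.psi (x * b) := by
  obtain ⟨z, rfl⟩ := sliceR_surj H.psi H.psi_ne a
  refine ⟨sliceR H.phi (H.T2.symm (H.T1 z)), fun x => ?_⟩
  rw [twoway, LinearEquiv.symm_apply_apply]
lemma psi_to_phi (a : A) : ∃ b, ∀ x, H.psi (x * a) = H.phi (x * b) := by
  obtain ⟨z, rfl⟩ := sliceR_surj H.phi H.phi_ne a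
  refine ⟨sliceR H.psi (H.T1.symm (H.T2 z)), fun x => ?_⟩
  rw [← twoway, LinearEquiv.symm_apply_apply]

lemma psi_kms (a x : A) :
    H.psi (a * x) = H.psi (x * H.S.symm (H.rho.symm (H.S a))) := by
  simp only [psi, LinearMap.comp_apply, LinearEquiv.coe_coe, H.S_mul, LinearEquiv.apply_symm_apply]
  rw [H.phi_kms (H.rho.symm (H.S a)), LinearEquiv.apply_symm_apply]

lemma lFun_to_rPsi (a : A) : ∃ b, H.lFun a = H.rPsi b := by
  obtain ⟨b, hb⟩ := H.phi_to_psi a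
  refine ⟨H.S.symm (H.rho (H.S b)), ?_⟩
  ext x
  simp only [lFun, LinearMap.comp_apply, LinearMap.mulRight_apply, LinearMap.mulLeft_apply]
  rw [hb, psi_kms H (H.S.symm (H.rho (H.S b)))]
  simp
lemma rPsi_to_lFun (a : A) : ∃ b, H.lFun b = H.rPsi a := by
  obtain ⟨b, hb⟩ := H.psi_to_phi (H.S.symm (H.rho.symm (H.S a)))
  refine ⟨b, ?_⟩
  ext x
  simp only [lFun, LinearMap.comp_apply, LinearMap.mulRight_apply, LinearMap.mulLeft_apply]
  rw [← hb, psi_kms H a]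

lemma range_eq : Set.range H.rPsi = Set.range H.lFun := by
  apply Set.Subset.antisymm
  · rintro _ ⟨a, rfl⟩
    exact H.rPsi_to_lFun a
  · rintro _ ⟨a, rfl⟩
    obtain ⟨b, hb⟩ := H.lFun_to_rPsi a
    exact ⟨b, hb.symm⟩

lemma Lact_eq (θ : A →ₗ[ℂ] ℂ) (a b : A) (h : H.lFun a = H.rPsi b) : H.Lact θ a = H.Lam θ b := by
  ext x
  have e : sliceL H.phi (H.T1 (x ⊗ₜ a)) = sliceL H.psi (H.T3 (x ⊗ₜ b)) := by
    refine H.cancel_r fun d => ?_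
    rw [← sliceL_R2, ← sliceL_R2, c1, ← c5]
    generalize H.T2 (x ⊗ₜ[ℂ] d) = z
    have h1 : sliceL H.phi (R1 A a z) = sliceL (H.lFun a) z := by
      induction z with
      | zero => simp
      | add x y hx hy => simp only [map_add, hx, hy]
      | tmul p q => simp [lFun]
    have h2 : sliceL H.psi (L1 A b z) = sliceL (H.rPsi b) z := by
      clear h1
      induction z with
      | zero => simp
      | add x y hx hy => simp only [map_add, hx, hy]
      | tmul p q => simp
    rw [h1, h2, h]
  exact congrArg θ e

end main
end AQG

/-- `θ ∈ A'` belongs to `M(Â)` (all slices of `Δ(a)` by `θ` lie in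
`A`) if and only if `θ ω ∈ Â` and `ω θ ∈ Â` for every `ω ∈ Â`. -/
theorem AQG.mem_multiplier_iff {A : Type*} [NonUnitalRing A] [Module ℂ A]
    [SMulCommClass ℂ A A] [IsScalarTower ℂ A A] (H : AQG A) (θ : A →ₗ[ℂ] ℂ) :
    H.HasSlices θ ↔
      ∀ a : A, H.Ract θ a ∈ Set.range H.lFun ∧ H.Lact θ a ∈ Set.range H.lFun := by
  constructor
  · intro h a
    constructor
    · obtain ⟨y, rfl⟩ := H.S.surjective a
      exact (H.R_iff θ y).1 (h y).1
    · obtain ⟨b, hb⟩ := H.lFun_to_rPsi a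
      obtain ⟨y, rfl⟩ := H.S.surjective b
      rw [H.Lact_eq θ a _ hb, ← H.range_eq]
      exact (H.L_iff θ y).1 (h y).2
  · intro h y
    refine ⟨(H.R_iff θ y).2 (h _).1, (H.L_iff θ y).2 ?_⟩
    obtain ⟨b, hb⟩ := H.rPsi_to_lFun (H.S y)
    rw [← H.Lact_eq θ b _ hb, H.range_eq]
    exact (h b).2
end
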